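/- For every finitely generated abelian group G, there exists a nonempty compact connected Hausdorff topological space N that is a topological 3-manifold (i.e. N is locally homeomorphic to ℝ³, equivalently admits a charted space structure modelled on Euclidean 3-space) such that the abelianization of the fundamental group of N is isomorphic to G. -/

import Mathlib

set_option linter.unusedSectionVars false

open Set Filter Topology unitInterval

noncomputable section

namespace M3

/-- A multiplicative, homotopy invariant functional on paths. -/
structure PF (X : Type) [TopologicalSpace X] (A : Type) [Group A] where
  w : ∀ {x y : X}, Path x y → A
  w_trans : ∀ {x y z : X} (γ : Path x y) (δ : Path y z), w (γ.trans δ) = w γ * w δ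
  w_hom : ∀ {x y : X} {γ δ : Path x y}, γ.Homotopic δ → w γ = w δ

namespace PF

variable {X Y : Type} [TopologicalSpace X] [TopologicalSpace Y] {A B : Type} [Group A] [Group B]

theorem w_refl (W : PF X A) (x : X) : W.w (Path.refl x) = 1 := by
  have h := W.w_trans (Path.refl x) (Path.refl x)
  rw [Path.refl_trans_refl] at h
  exact (left_eq_mul.mp h)

theorem w_symm (W : PF X A) {x y : X} (γ : Path x y) : W.w γ.symm = (W.w γ)⁻¹ := by
  have h := W.w_trans γ γ.symm
  have h2 : W.w (γ.trans γ.symm) = W.w (Path.refl x) :=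
    W.w_hom ⟨(Path.Homotopy.reflTransSymm γ).symm⟩
  rw [h2, w_refl] at h
  exact eq_inv_of_mul_eq_one_right h.symm

theorem w_congr (W : PF X A) {x y x' y' : X} (γ : Path x y) (δ : Path x' y')
    (h : ∀ t, γ t = δ t) : W.w γ = W.w δ := by
  have hx : x = x' := by simpa using h 0
  have hy : y = y' := by simpa using h 1
  subst hx hy
  congr 1
  ext t; exact h t

theorem w_const (W : PF X A) {x y : X} (γ : Path x y) (h : ∀ t, γ t = x) : W.w γ = 1 := by
  rw [← W.w_refl x]
  exact W.w_congr _ _ (by simpa using h)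

/-- pullback -/
def comap (W : PF X A) (f : C(Y, X)) : PF Y A where
  w γ := W.w (γ.map f.continuous)
  w_trans γ δ := by rw [← W.w_trans, Path.map_trans]
  w_hom h := W.w_hom (h.map f)

/-- pushforward of coefficients -/
def push (W : PF X A) (f : A →* B) : PF X B where
  w γ := f (W.w γ)
  w_trans γ δ := by rw [W.w_trans, map_mul]
  w_hom h := by rw [W.w_hom h]

theorem exists_pot (W : PF X A) [SimplyConnectedSpace X] :
    ∃ u : X → A, ∀ {x y : X} (γ : Path x y), W.w γ = (u x)⁻¹ * u y := by
  obtain ⟨x0⟩ := (inferInstance : Nonempty X)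
  refine ⟨fun x => W.w (PathConnectedSpace.somePath x0 x), fun {x y} γ => ?_⟩
  rw [eq_inv_mul_iff_mul_eq, ← W.w_trans]
  exact W.w_hom (SimplyConnectedSpace.paths_homotopic _ _)

end PF

/-- A straight segment as a continuous map. -/
def segMap {E : Type} [NormedAddCommGroup E] [NormedSpace ℝ E] (a b : E) : C(I, E) :=
  ⟨fun t => AffineMap.lineMap a b (t : ℝ), by
    simp only [AffineMap.lineMap_apply_module]; fun_prop⟩

theorem segMap_mem {E : Type} [NormedAddCommGroup E] [NormedSpace ℝ E] {C : Set E}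
    (hC : Convex ℝ C) {a b : E} (ha : a ∈ C) (hb : b ∈ C) (t : I) : segMap a b t ∈ C :=
  hC.lineMap_mem ha hb t.2

section ext

variable {X : Type} [TopologicalSpace X] {A : Type} [Group A]

open Classical in
/-- The weight of a map of the interval landing in `U`. -/
def phi (U : Set X) (W : PF U A) (c : C(I, X)) : A :=
  if h : ∀ t, c t ∈ U then
    W.w (x := ⟨c 0, h 0⟩) (y := ⟨c 1, h 1⟩) ⟨⟨fun t => ⟨c t, h t⟩, by fun_prop⟩, rfl, rfl⟩ else 1

variable {E : Type} [NormedAddCommGroup E] [NormedSpace ℝ E]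

def fK (U : Set X) (W : PF U A) (K : C(E, X)) (a b : E) : A := phi U W (K.comp (segMap a b))

theorem fK_cocycle_U (U : Set X) (W : PF U A) (K : C(E, X)) {C : Set E} (hC : Convex ℝ C)
    (hU : ∀ x ∈ C, K x ∈ U) {a b c : E} (ha : a ∈ C) (hb : b ∈ C) (hc : c ∈ C) :
    fK U W K a b * fK U W K b c = fK U W K a c := by
  have : ContractibleSpace C := hC.contractibleSpace ⟨a, ha⟩
  let k : C(C, U) := ⟨fun x => ⟨K x, hU x x.2⟩, by fun_prop⟩
  obtain ⟨u, hu⟩ := (W.comap k).exists_pot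
  have key : ∀ (p q : E) (hp : p ∈ C) (hq : q ∈ C),
      fK U W K p q = (u ⟨p, hp⟩)⁻¹ * u ⟨q, hq⟩ := by
    intro p q hp hq
    have hh : ∀ t, (K.comp (segMap p q)) t ∈ U := fun t => hU _ (segMap_mem hC hp hq t)
    let γ : Path (⟨p, hp⟩ : C) ⟨q, hq⟩ :=
      ⟨⟨fun t => ⟨segMap p q t, segMap_mem hC hp hq t⟩, by fun_prop⟩,
        Subtype.ext (by simp [segMap]), Subtype.ext (by simp [segMap])⟩
    rw [← hu γ, fK, phi, dif_pos hh]
    exact W.w_congr _ _ (fun t => rfl)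
  rw [key _ _ ha hb, key _ _ hb hc, key _ _ ha hc]
  group

theorem fK_V (U V : Set X) (W : PF U A)
    (hUV : ∀ (x y : U) (γ : Path x y), (∀ t, (γ t : X) ∈ V) → W.w γ = 1)
    (K : C(E, X)) {C : Set E} (hC : Convex ℝ C)
    (hV : ∀ x ∈ C, K x ∈ V) {a b : E} (ha : a ∈ C) (hb : b ∈ C)  :
    fK U W K a b = 1 := by
  rw [fK, phi]
  split_ifs with h
  · exact hUV _ _ _ (fun t => hV _ (segMap_mem hC ha hb t))
  · rfl

/-- Local potential. -/
def IsPot (f : E → E → A) (C : Set E) (g : E → A) : Prop :=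
  ∀ s ∈ C, ∀ᶠ t in 𝓝[C] s, g t = g s * f s t

/-- local cocycle condition. -/
def LocCoc (f : E → E → A) (C : Set E) : Prop :=
  ∀ D : Set E, D ⊆ C → Convex ℝ D → ∀ a ∈ D, ∀ b ∈ D, ∀ c ∈ D, f a b * f b c = f a c

theorem eq_of_locconst {T : Type} [TopologicalSpace T] {C : Set T} (hC : IsPreconnected C)
    {A : Type} (h : T → A) (hloc : ∀ s ∈ C, ∀ᶠ t in 𝓝[C] s, h t = h s) {a b : T} (ha : a ∈ C)
    (hb : b ∈ C) : h a = h b := by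
  have := isPreconnected_iff_preconnectedSpace.mp hC
  have hl : IsLocallyConstant (fun x : C => h x) := by
    rw [IsLocallyConstant.iff_eventually_eq]
    intro x
    have := hloc x x.2
    rw [nhdsWithin_eq_map_subtype_coe x.2] at this
    exact this
  exact hl.apply_eq_of_isPreconnected isPreconnected_univ (mem_univ (⟨a, ha⟩ : C))
    (mem_univ (⟨b, hb⟩ : C))

theorem IsPot.unique {f : E → E → A} {C : Set E} {g g' : E → A} (hC : IsPreconnected C)
    (h : IsPot f C g) (h' : IsPot f C g') {a b : E} (ha : a ∈ C) (hb : b ∈ C) :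
    (g a)⁻¹ * g b = (g' a)⁻¹ * g' b := by
  have := eq_of_locconst hC (fun t => g t * (g' t)⁻¹) (fun s hs => by
    filter_upwards [h s hs, h' s hs] with t h1 h2
    rw [h1, h2]; group) ha hb

  have h3 : g b = g a * (g' a)⁻¹ * g' b := by rw [this]; group
  rw [h3]; group

theorem IsPot.eq_of_convex {f : E → E → A} {C : Set E} {g : E → A} (h : IsPot f C g)
    (hC : Convex ℝ C) (hf : LocCoc f C) {a b : E} (ha : a ∈ C) (hb : b ∈ C) :
    (g a)⁻¹ * g b = f a b := by
  have h' : IsPot f C (fun t => f a t) := fun s hs => by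
    filter_upwards [self_mem_nhdsWithin] with t ht
    exact (hf C subset_rfl hC a ha s hs t ht).symm
  rw [h.unique hC.isPreconnected h' ha hb]
  have := hf C subset_rfl hC a ha a ha a ha
  rw [mul_eq_left.mp this]; simp

theorem exists_isPot_of_convex {f : E → E → A} {C : Set E} 
    (hC : Convex ℝ C) (hf : LocCoc f C) : ∃ g, IsPot f C g := by
  by_cases hne : C.Nonempty
  · obtain ⟨a, ha⟩ := hne
    refine ⟨fun t => f a t, fun s hs => ?_⟩
    filter_upwards [self_mem_nhdsWithin] with t ht
    exact (hf C subset_rfl hC a ha s hs t ht).symm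
  · exact ⟨1, fun s hs => (hne ⟨s, hs⟩).elim⟩

theorem IsPot.mono {f : E → E → A} {C D : Set E} {g : E → A} (h : IsPot f C g) (hD : D ⊆ C) :
    IsPot f D g := fun s hs => (h s (hD hs)).filter_mono (nhdsWithin_mono _ hD)

theorem IsPot.glue {f : E → E → A} {C D : Set E} (hC : IsClosed C) (hD : IsClosed D)
    (hCD : IsPreconnected (C ∩ D)) (h1 : ∃ g, IsPot f C g) (h2 : ∃ g, IsPot f D g) :
    ∃ g, IsPot f (C ∪ D) g := by
  classical
  obtain ⟨g1, h1⟩ := h1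
  obtain ⟨g2, h2⟩ := h2
  obtain ⟨k, hk⟩ : ∃ k : A, ∀ x ∈ C ∩ D, g1 x = k * g2 x := by
    by_cases hne : (C ∩ D).Nonempty
    · obtain ⟨a, ha⟩ := hne
      refine ⟨g1 a * (g2 a)⁻¹, fun x hx => ?_⟩
      have := (h1.mono inter_subset_left).unique hCD (h2.mono inter_subset_right) ha hx
      rw [mul_assoc, ← this]; group
    · exact ⟨1, fun x hx => (hne ⟨x, hx⟩).elim⟩
  have h2' : IsPot f D (fun x => k * g2 x) := fun s hs => by
    filter_upwards [h2 s hs] with t ht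
    rw [ht, mul_assoc]
  refine ⟨fun x => if x ∈ C then g1 x else k * g2 x, fun s hs => ?_⟩
  have hg1 : ∀ x ∈ C, (if x ∈ C then g1 x else k * g2 x) = g1 x := fun x hx => if_pos hx
  have hg2 : ∀ x ∈ D, (if x ∈ C then g1 x else k * g2 x) = k * g2 x := fun x hx => by
    split_ifs with h
    · exact hk x ⟨h, hx⟩
    · rfl
  rw [nhdsWithin_union, eventually_sup]
  constructor
  · by_cases hsC : s ∈ C
    · filter_upwards [h1 s hsC, self_mem_nhdsWithin] with t ht htC
      rw [hg1 t htC, hg1 s hsC, ht]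
    · have : 𝓝[C] s = ⊥ := by
        rw [← notMem_closure_iff_nhdsWithin_eq_bot, hC.closure_eq]; exact hsC
      rw [this]; exact eventually_bot
  · by_cases hsC : s ∈ D
    · filter_upwards [h2' s hsC, self_mem_nhdsWithin] with t ht htC
      rw [hg2 t htC, hg2 s hsC, ht]
    · have : 𝓝[D] s = ⊥ := by
        rw [← notMem_closure_iff_nhdsWithin_eq_bot, hD.closure_eq]; exact hsC
      rw [this]; exact eventually_bot

end ext

/-- Potentials on the unit square. -/
theorem exists_isPot_square {A : Type} [Group A] (f : ℝ × ℝ → ℝ × ℝ → A) (O : Bool → Set (ℝ × ℝ))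
    (hO : ∀ i, IsOpen (O i)) (hcov : Icc (0 : ℝ) 1 ×ˢ Icc (0 : ℝ) 1 ⊆ ⋃ i, O i)
    (hf : ∀ i, LocCoc f (O i)) : ∃ g, IsPot f (Icc (0 : ℝ) 1 ×ˢ Icc (0 : ℝ) 1) g := by
  obtain ⟨t, ht0, hmono, ⟨n, hn⟩, hsub⟩ := exists_monotone_Icc_subset_open_cover_unitInterval_prod_self
    (c := fun i => (fun p : I × I => ((p.1 : ℝ), (p.2 : ℝ))) ⁻¹' O i)
    (fun i => (hO i).preimage (by fun_prop))
    (fun p _ => by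
      have := hcov (a := ((p.1 : ℝ), (p.2 : ℝ))) ⟨p.1.2, p.2.2⟩
      simpa using this)
  let τ : ℕ → ℝ := fun k => t k
  have hτ : Monotone τ := fun a b h => hmono h
  have hτ0 : τ 0 = 0 := by simp [τ, ht0]
  have hτn : τ n = 1 := by simp [τ, hn n le_rfl]
  have cell : ∀ a b, ∃ g, IsPot f (Icc (τ a) (τ (a+1)) ×ˢ Icc (τ b) (τ (b+1))) g := by
    intro a b
    obtain ⟨i, hi⟩ := hsub a b
    refine exists_isPot_of_convex ((convex_Icc _ _).prod (convex_Icc _ _)) ?_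
    intro D hD
    refine hf i D (hD.trans ?_)
    rintro ⟨x, y⟩ ⟨hx, hy⟩
    have hx' : x ∈ Icc (0 : ℝ) 1 := ⟨(t a).2.1.trans hx.1, hx.2.trans (t (a+1)).2.2⟩
    have hy' : y ∈ Icc (0 : ℝ) 1 := ⟨(t b).2.1.trans hy.1, hy.2.trans (t (b+1)).2.2⟩
    exact hi (a := ((⟨x, hx'⟩ : I), (⟨y, hy'⟩ : I))) ⟨hx, hy⟩
  have union : ∀ k, Icc (τ 0) (τ k) ∪ Icc (τ k) (τ (k+1)) = Icc (τ 0) (τ (k+1)) := fun k =>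
    Icc_union_Icc_eq_Icc (hτ (Nat.zero_le _)) (hτ (Nat.le_succ _))
  have row : ∀ b a, ∃ g, IsPot f (Icc (τ 0) (τ a) ×ˢ Icc (τ b) (τ (b+1))) g := by
    intro b a
    induction a with
    | zero =>
      obtain ⟨g, hg⟩ := cell 0 b
      exact ⟨g, hg.mono (prod_mono (Icc_subset_Icc le_rfl (hτ (Nat.le_succ _))) subset_rfl)⟩
    | succ a ih =>
      rw [← union, union_prod]
      refine IsPot.glue (isClosed_Icc.prod isClosed_Icc) (isClosed_Icc.prod isClosed_Icc) ?_ ih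
        (cell a b)
      exact (((convex_Icc _ _).prod (convex_Icc _ _)).inter
        ((convex_Icc _ _).prod (convex_Icc _ _))).isPreconnected
  have all : ∀ b, ∃ g, IsPot f (Icc (τ 0) (τ n) ×ˢ Icc (τ 0) (τ b)) g := by
    intro b
    induction b with
    | zero =>
      obtain ⟨g, hg⟩ := row 0 n
      exact ⟨g, hg.mono (prod_mono subset_rfl (Icc_subset_Icc le_rfl (hτ (Nat.le_succ _))))⟩
    | succ b ih =>
      rw [← union, prod_union]
      refine IsPot.glue (isClosed_Icc.prod isClosed_Icc) (isClosed_Icc.prod isClosed_Icc) ?_ ih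
        (row b n)
      exact (((convex_Icc _ _).prod (convex_Icc _ _)).inter
        ((convex_Icc _ _).prod (convex_Icc _ _))).isPreconnected
  have := all n
  rwa [hτ0, hτn] at this

end M3

namespace M3

section ext2

variable {X : Type} [TopologicalSpace X] {A : Type} [Group A]
variable {E : Type} [NormedAddCommGroup E] [NormedSpace ℝ E]

/-- a path as a map from the real line -/
def pext {x y : X} (γ : Path x y) : C(ℝ, X) := ⟨γ.extend, γ.continuous_extend⟩

theorem pext_apply {x y : X} (γ : Path x y) (t : I) : pext γ t = γ t := by
  simp [pext]

theorem IsPot.restrict {U : Set X} {W : PF U A} {K : C(E, X)} {C : Set E} {g : E → A}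
    (hg : IsPot (fK U W K) C g) (hC : Convex ℝ C) {p q : E} (hp : p ∈ C) (hq : q ∈ C)
    {x y : X} (γ : Path x y) (hK : ∀ t : I, K (AffineMap.lineMap p q (t : ℝ)) = γ t) :
    IsPot (fK U W (pext γ)) (Icc (0 : ℝ) 1) (fun t => g (AffineMap.lineMap p q t)) := by
  intro s hs
  have hcont : Continuous (fun t : ℝ => (AffineMap.lineMap p q t : E)) := by
    simp only [AffineMap.lineMap_apply_module]; fun_prop
  have hmaps : MapsTo (fun t : ℝ => (AffineMap.lineMap p q t : E)) (Icc (0 : ℝ) 1) C :=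
    fun t ht => hC.lineMap_mem hp hq ht
  have hT : Tendsto (fun t : ℝ => (AffineMap.lineMap p q t : E)) (𝓝[Icc (0 : ℝ) 1] s)
      (𝓝[C] (AffineMap.lineMap p q s)) :=
    hcont.continuousWithinAt.tendsto_nhdsWithin hmaps
  filter_upwards [hT.eventually (hg _ (hmaps hs)), self_mem_nhdsWithin] with t ht htI
  rw [ht]
  congr 1
  unfold fK
  congr 1
  ext r
  have hr : segMap s t r ∈ Icc (0 : ℝ) 1 := segMap_mem (convex_Icc _ _) hs htI r
  have h1 := hK ⟨segMap s t r, hr⟩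
  have h2 := pext_apply γ ⟨segMap s t r, hr⟩
  simp only [ContinuousMap.comp_apply]
  simp only at h1 h2
  rw [h2, ← h1]
  congr 1
  exact (AffineMap.apply_lineMap (AffineMap.lineMap p q) s t (r : ℝ)).symm

theorem exists_square_pot {U V : Set X} (hU : IsOpen U) (hV : IsOpen V) (hcov : ∀ x, x ∈ U ∨ x ∈ V)
    (W : PF U A) (hUV : ∀ (x y : U) (γ : Path x y), (∀ t, (γ t : X) ∈ V) → W.w γ = 1)
    (K : C(ℝ × ℝ, X)) : ∃ g, IsPot (fK U W K) (Icc (0 : ℝ) 1 ×ˢ Icc (0 : ℝ) 1) g := by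
  refine exists_isPot_square _ (fun i => K ⁻¹' (if i = true then U else V)) ?_ ?_ ?_
  · intro i
    cases i
    · simpa using hV.preimage K.continuous
    · simpa using hU.preimage K.continuous
  · intro x _
    rw [mem_iUnion]
    rcases hcov (K x) with h | h
    · exact ⟨true, by simpa using h⟩
    · exact ⟨false, by simpa using h⟩
  · intro i D hD hDc a ha b hb c hc
    cases i
    · have hD' : ∀ x ∈ D, K x ∈ V := fun x hx => by simpa using hD hx
      rw [fK_V U V W hUV K hDc hD' ha hb, fK_V U V W hUV K hDc hD' hb hc,
        fK_V U V W hUV K hDc hD' ha hc, mul_one]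
    · have hD' : ∀ x ∈ D, K x ∈ U := fun x hx => by simpa using hD hx
      exact fK_cocycle_U U W K hDc hD' ha hb hc

theorem convex_sq : Convex ℝ (Icc (0 : ℝ) 1 ×ˢ Icc (0 : ℝ) 1) :=
  (convex_Icc _ _).prod (convex_Icc _ _)

theorem exists_path_pot {U V : Set X} (hU : IsOpen U) (hV : IsOpen V) (hcov : ∀ x, x ∈ U ∨ x ∈ V)
    (W : PF U A) (hUV : ∀ (x y : U) (γ : Path x y), (∀ t, (γ t : X) ∈ V) → W.w γ = 1)
    {x y : X} (γ : Path x y) : ∃ g, IsPot (fK U W (pext γ)) (Icc (0 : ℝ) 1) g := by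
  obtain ⟨g, hg⟩ := exists_square_pot hU hV hcov W hUV ((pext γ).comp ⟨Prod.snd, continuous_snd⟩)
  refine ⟨_, hg.restrict convex_sq (p := (0, 0)) (q := (0, 1)) (by simp) (by simp) γ ?_⟩
  intro t
  simpa [AffineMap.lineMap_apply_module] using pext_apply γ t

theorem PF.exists_extension {U V : Set X} (hU : IsOpen U) (hV : IsOpen V)
    (hcov : ∀ x, x ∈ U ∨ x ∈ V)
    (W : PF U A) (hUV : ∀ (x y : U) (γ : Path x y), (∀ t, (γ t : X) ∈ V) → W.w γ = 1) :
    ∃ W' : PF X A, ∀ (x y : U) (γ : Path x y), W'.w (γ.map continuous_subtype_val) = W.w γ := by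
  choose G hG using fun (x y : X) (γ : Path x y) => exists_path_pot hU hV hcov W hUV γ
  let val : ∀ {x y : X}, Path x y → A := fun {x y} γ => (G x y γ 0)⁻¹ * G x y γ 1
  have hval : ∀ {x y : X} (γ : Path x y) (g : ℝ → A),
      IsPot (fK U W (pext γ)) (Icc (0 : ℝ) 1) g → val γ = (g 0)⁻¹ * g 1 := fun γ g hg =>
    (hG _ _ γ).unique isPreconnected_Icc hg (by simp) (by simp)
  have hvalK : ∀ {E : Type} [NormedAddCommGroup E] [NormedSpace ℝ E] {K : C(E, X)} {C : Set E}
    {g : E → A} (hg : IsPot (fK U W K) C g) (hC : Convex ℝ C) (p q : E) (hp : p ∈ C) (hq : q ∈ C)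
    {x y : X} (γ : Path x y) (hK : ∀ t : I, K (AffineMap.lineMap p q (t : ℝ)) = γ t),
      val γ = (g p)⁻¹ * g q := by
    intro E _ _ K C g hg hC p q hp hq x y γ hK
    rw [hval γ _ (hg.restrict hC hp hq γ hK)]
    simp
  have hsub : ∀ {x y : U} (γ : Path x y), val (γ.map continuous_subtype_val) = W.w γ := by
    intro x y γ
    have hmem : ∀ t ∈ Icc (0 : ℝ) 1, pext (γ.map continuous_subtype_val) t ∈ U := fun t ht => by
      have := pext_apply (γ.map continuous_subtype_val) ⟨t, ht⟩
      simp only at this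
      rw [this]; simp
    have h1 := (hG _ _ (γ.map continuous_subtype_val)).eq_of_convex (convex_Icc _ _)
      (fun D hD hDc a ha b hb c hc => fK_cocycle_U U W _ hDc (fun x hx => hmem x (hD hx))
        ha hb hc) (a := 0) (b := 1) (by simp) (by simp)
    refine h1.trans ?_
    have hh : ∀ t, ((pext (γ.map continuous_subtype_val)).comp (segMap 0 1)) t ∈ U := fun t =>
      hmem _ (segMap_mem (convex_Icc _ _) (by simp) (by simp) t)
    rw [fK, phi, dif_pos hh]
    refine W.w_congr _ _ (fun t => Subtype.ext ?_)
    have : segMap (0 : ℝ) 1 t = t := by simp [segMap, AffineMap.lineMap_apply_module]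
    change pext (γ.map continuous_subtype_val) (segMap 0 1 t) = _
    rw [this, pext_apply]; rfl
  have hconst : ∀ (x y : X) (γ : Path x y), (∀ t, γ t = x) → val γ = 1 := by
    intro x y γ hγ
    have hp : IsPot (fK U W (pext γ)) (Icc (0 : ℝ) 1) (fun _ => 1) := by
      intro s hs
      filter_upwards [self_mem_nhdsWithin] with t ht
      rw [fK, phi]
      split_ifs with h
      · rw [W.w_const, mul_one]
        intro r
        apply Subtype.ext
        have h0 : ∀ t ∈ Icc (0 : ℝ) 1, pext γ t = x := fun t ht =>
          (pext_apply γ ⟨t, ht⟩).trans (hγ _)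
        change pext γ (segMap s t r) = pext γ (segMap s t 0)
        rw [h0 _ (segMap_mem (convex_Icc _ _) hs ht r), h0 _ (segMap_mem (convex_Icc _ _) hs ht 0)]
      · simp
    rw [hval γ _ hp]; simp
  refine ⟨⟨val, ?_, ?_⟩, fun x y γ => hsub γ⟩
  · intro x y z γ δ
    have hg := hG _ _ (γ.trans δ)
    have h1 := hvalK hg (convex_Icc _ _) 0 (1/2) (by simp) (by constructor <;> norm_num) γ (by
      intro t
      have h2 : (1/2 : ℝ) * t ∈ Icc (0 : ℝ) 1 :=
        ⟨by have := t.2.1; positivity, by have := t.2.2; linarith⟩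
      have h3 : (AffineMap.lineMap (0 : ℝ) (1/2) (t : ℝ) : ℝ) = 1/2 * t := by
        simp [AffineMap.lineMap_apply_module, mul_comm]
      rw [h3]
      refine (pext_apply (γ.trans δ) ⟨_, h2⟩).trans ?_
      rw [Path.trans_apply, dif_pos (by have := t.2.2; simp only; linarith)]
      congr 1
      apply Subtype.ext
      simp)
    have h2 := hvalK hg (convex_Icc _ _) (1/2) 1 (by constructor <;> norm_num) (by simp) δ (by
      intro t
      have h2 : (1 + t : ℝ) / 2 ∈ Icc (0 : ℝ) 1 :=
        ⟨by have := t.2.1; positivity, by have := t.2.2; linarith⟩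
      have h3 : (AffineMap.lineMap (1/2 : ℝ) 1 (t : ℝ) : ℝ) = (1 + t : ℝ) / 2 := by
        simp only [AffineMap.lineMap_apply_module, smul_eq_mul]; ring
      rw [h3]
      refine (pext_apply (γ.trans δ) ⟨_, h2⟩).trans ?_
      rw [Path.trans_apply]
      split_ifs with h
      · have ht : t = 0 := by
          apply Subtype.ext
          have := t.2.1
          simp only at h
          simp only [Icc.coe_zero]
          linarith
        subst ht
        simp
      · congr 1
        apply Subtype.ext
        simp only
        ring)
    rw [h1, h2]
    change (G x z _ 0)⁻¹ * G x z _ 1 = _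
    group
  · rintro x y γ δ ⟨H⟩
    let pr : C(ℝ, I) := ⟨projIcc (0 : ℝ) 1 zero_le_one, continuous_projIcc⟩
    have hpr : ∀ t : I, pr t = t := fun t => projIcc_val zero_le_one t
    have hpr0 : pr 0 = 0 := hpr 0
    have hpr1 : pr 1 = 1 := hpr 1
    let K : C(ℝ × ℝ, X) := H.toContinuousMap.comp (pr.prodMap pr)
    have hKa : ∀ s t, K (s, t) = H (pr s, pr t) := fun s t => rfl
    obtain ⟨g, hg⟩ := exists_square_pot hU hV hcov W hUV K
    have e1 := hvalK hg convex_sq (0, 0) (0, 1) (by simp) (by simp) γ (by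
      intro t; simp [AffineMap.lineMap_apply_module, hKa, hpr, hpr0])
    have e2 := hvalK hg convex_sq (1, 0) (1, 1) (by simp) (by simp) δ (by
      intro t; simp [AffineMap.lineMap_apply_module, hKa, hpr, hpr1])
    have e3 := hvalK hg convex_sq (0, 0) (1, 0) (by simp) (by simp) (Path.refl x) (by
      intro t; simp [AffineMap.lineMap_apply_module, hKa, hpr, hpr0])
    have e4 := hvalK hg convex_sq (0, 1) (1, 1) (by simp) (by simp) (Path.refl y) (by
      intro t; simp [AffineMap.lineMap_apply_module, hKa, hpr, hpr1])
    rw [hconst _ _ _ (fun _ => rfl), eq_comm, inv_mul_eq_one] at e3 e4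
    change val γ = val δ
    rw [e1, e2, e3, e4]

/-- Generation: a functional which is a coboundary on two open sets covering `X`. -/
theorem PF.eq_of_local {U V : Set X} (hU : IsOpen U) (hV : IsOpen V)
    (hcov : ∀ x, x ∈ U ∨ x ∈ V) (W : PF X A) (u : X → A)
    (h1 : ∀ {x y : X} (γ : Path x y), (∀ t, γ t ∈ U) → W.w γ = (u x)⁻¹ * u y)
    (h2 : ∀ {x y : X} (γ : Path x y), (∀ t, γ t ∈ V) → W.w γ = (u x)⁻¹ * u y)
    {x y : X} (γ : Path x y) : W.w γ = (u x)⁻¹ * u y := by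
  obtain ⟨p, hp⟩ := (W.comap (pext γ)).exists_pot
  have key : ∀ O : Set X, IsOpen O → (∀ {x y : X} (γ : Path x y), (∀ t, γ t ∈ O) →
      W.w γ = (u x)⁻¹ * u y) → ∀ s : ℝ, pext γ s ∈ O →
      ∀ᶠ t in 𝓝 s, p t * (u (pext γ t))⁻¹ = p s * (u (pext γ s))⁻¹ := by
    intro O hO h s hs
    obtain ⟨ε, hε, hb⟩ := Metric.isOpen_iff.mp (hO.preimage (pext γ).continuous) s hs
    filter_upwards [Metric.ball_mem_nhds s hε] with t ht
    let δ : Path s t := ⟨segMap s t, by simp [segMap], by simp [segMap]⟩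
    have e1 := hp δ
    have e2 := h (δ.map (pext γ).continuous) (fun r =>
      hb (segMap_mem (convex_ball s ε) (Metric.mem_ball_self hε) ht r))
    change W.w (δ.map (pext γ).continuous) = _ at e1
    rw [e1] at e2
    have e3 : p t = p s * ((u (pext γ s))⁻¹ * u (pext γ t)) := by rw [← e2]; group
    rw [e3]; group
  have hc := eq_of_locconst (C := univ) isPreconnected_univ
    (fun t => p t * (u (pext γ t))⁻¹) (fun s _ => by
      rw [nhdsWithin_univ]
      rcases hcov (pext γ s) with h | h
      · exact key U hU h1 s h
      · exact key V hV h2 s h) (mem_univ (0 : ℝ)) (mem_univ (1 : ℝ))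
  let δ : Path (0 : ℝ) 1 := ⟨segMap 0 1, by simp [segMap], by simp [segMap]⟩
  have e1 : W.w γ = (p 0)⁻¹ * p 1 := by
    rw [← hp δ]
    refine W.w_congr _ _ (fun t => ?_)
    rw [← pext_apply]
    have : segMap (0 : ℝ) 1 t = t := by simp [segMap, AffineMap.lineMap_apply_module]
    change _ = pext γ (segMap 0 1 t)
    rw [this]
  have p0 : pext γ 0 = x := by simpa using pext_apply γ 0
  have p1 : pext γ 1 = y := by simpa using pext_apply γ 1
  simp only [p0, p1] at hc
  have e3 : p 1 = p 0 * (u x)⁻¹ * u y := by rw [hc]; group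
  rw [e1, e3]; group

end ext2

end M3

namespace M3

section h1

variable {X Y : Type} [TopologicalSpace X] [TopologicalSpace Y] {A : Type}

theorem trans_mem {x y z : X} {γ : Path x y} {δ : Path y z} {U : Set X} (h1 : ∀ t, γ t ∈ U)
    (h2 : ∀ t, δ t ∈ U) (t : I) : γ.trans δ t ∈ U := by
  have : range (γ.trans δ) ⊆ U := by
    rw [Path.trans_range]
    exact union_subset (range_subset_iff.mpr h1) (range_subset_iff.mpr h2)
  exact this (mem_range_self t)

theorem PF.loops_trivial [Group A] {U V : Set X} (hU : IsOpen U) (hV : IsOpen V)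
    (hcov : ∀ x, x ∈ U ∨ x ∈ V) (pU : IsPathConnected U) (pV : IsPathConnected V)
    (pUV : IsPathConnected (U ∩ V)) (W : PF X A)
    (h1 : ∀ (x : X) (γ : Path x x), (∀ t, γ t ∈ U) → W.w γ = 1)
    (h2 : ∀ (x : X) (γ : Path x x), (∀ t, γ t ∈ V) → W.w γ = 1)
    {x : X} (γ : Path x x) : W.w γ = 1 := by
  obtain ⟨x0, hx0⟩ := pUV.nonempty
  have hδ : ∀ x : X, ∃ δ : Path x0 x, (x ∈ U → ∀ t, δ t ∈ U) ∧ (x ∈ V → ∀ t, δ t ∈ V) := by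
    intro x
    by_cases hxU : x ∈ U
    · by_cases hxV : x ∈ V
      · obtain ⟨δ, hδ⟩ := pUV.joinedIn x0 hx0 x ⟨hxU, hxV⟩
        exact ⟨δ, fun _ t => (hδ t).1, fun _ t => (hδ t).2⟩
      · obtain ⟨δ, hδ⟩ := pU.joinedIn x0 hx0.1 x hxU
        exact ⟨δ, fun _ t => hδ t, fun h => (hxV h).elim⟩
    · obtain ⟨δ, hδ⟩ := pV.joinedIn x0 hx0.2 x ((hcov x).resolve_left hxU)
      exact ⟨δ, fun h => (hxU h).elim, fun _ t => hδ t⟩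
  choose δ hδU hδV using hδ
  have key : ∀ (O : Set X), (∀ (x : X) (γ : Path x x), (∀ t, γ t ∈ O) → W.w γ = 1) →
      (∀ x ∈ O, ∀ t, δ x t ∈ O) → ∀ {x y : X} (γ : Path x y), (∀ t, γ t ∈ O) →
      W.w γ = (W.w (δ x))⁻¹ * W.w (δ y) := by
    intro O hO hδO x y γ hγ
    have hx : x ∈ O := by simpa using hγ 0
    have hy : y ∈ O := by simpa using hγ 1
    have := hO _ (((δ x).trans γ).trans (δ y).symm) (trans_mem (trans_mem (hδO x hx) hγ)
      (fun t => hδO y hy _))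
    rw [W.w_trans, W.w_trans, W.w_symm, mul_inv_eq_one] at this
    rw [← this]; group
  rw [PF.eq_of_local hU hV hcov W (fun x => W.w (δ x)) (key U h1 hδU) (key V h2 hδV) γ]
  simp

/-- The hom out of the fundamental group given by a functional. -/
def PF.toHom [CommGroup A] (W : PF X A) (x : X) : FundamentalGroup X x →* A where
  toFun := Quotient.lift (fun γ : Path x x => W.w γ) (fun _ _ h => W.w_hom h)
  map_one' := W.w_refl x
  map_mul' p q := by
    induction p using Path.Homotopic.Quotient.ind with | mk p =>
    induction q using Path.Homotopic.Quotient.ind with | mk q =>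
    exact (W.w_trans q p).trans (mul_comm _ _)

theorem PF.toHom_mk [CommGroup A] (W : PF X A) (x : X) (γ : Path x x) :
    W.toHom x (Path.Homotopic.Quotient.mk γ) = W.w γ := rfl

open Path.Homotopic.Quotient in
/-- The functional given by a hom out of the fundamental group. -/
def canon [Group A] (x0 : X) (τ : ∀ x, Path x0 x) (ψ : FundamentalGroup X x0 →* A) : PF X A where
  w {x y} γ := (ψ (mk (((τ x).trans γ).trans (τ y).symm)))⁻¹
  w_trans {x y z} γ δ := by
    rw [← mul_inv_rev, ← map_mul, FundamentalGroup.mul_def]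
    congr 2
    simp only [mk_trans, mk_symm]
    grind
  w_hom {x y γ δ} h := by
    congr 2
    simp only [mk_trans, mk_symm, Path.Homotopic.Quotient.eq.mpr h]

theorem canon_w [Group A] (x0 : X) (τ : ∀ x, Path x0 x) (ψ : FundamentalGroup X x0 →* A)
    {x y : X} (γ : Path x y) : (canon x0 τ ψ).w γ =
      (ψ (Path.Homotopic.Quotient.mk (((τ x).trans γ).trans (τ y).symm)))⁻¹ := rfl

theorem canon_loop [CommGroup A] (x0 : X) (τ : ∀ x, Path x0 x) (ψ : FundamentalGroup X x0 →* A)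
    (γ : Path x0 x0) : (canon x0 τ ψ).w γ = (ψ (Path.Homotopic.Quotient.mk γ))⁻¹ := by
  rw [canon_w]
  congr 1
  let t : FundamentalGroup X x0 := Path.Homotopic.Quotient.mk (τ x0)
  let g : FundamentalGroup X x0 := Path.Homotopic.Quotient.mk γ
  have : (Path.Homotopic.Quotient.mk (((τ x0).trans γ).trans (τ x0).symm) : FundamentalGroup X x0)
    = t⁻¹ * (g * t) := rfl
  rw [this, map_mul, map_mul, map_inv]
  simp [g]

/-- `W` is the universal functional: it identifies `A` with the first homology. -/
def PF.IsH1 [CommGroup A] (W : PF X A) : Prop :=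
  (∀ a, ∃ (x : X) (γ : Path x x), W.w γ = a) ∧
  ∀ (B : Type) (_ : CommGroup B) (W' : PF X B), ∃ h : A →* B, ∀ (x : X) (γ : Path x x),
    W'.w γ = h (W.w γ)

theorem PF.exists_loop_at [CommGroup A] (W : PF X A) [PathConnectedSpace X] {x : X} (x0 : X)
    (γ : Path x x) : ∃ δ : Path x0 x0, W.w δ = W.w γ := by
  let τ := PathConnectedSpace.somePath x0 x
  refine ⟨(τ.trans γ).trans τ.symm, ?_⟩
  rw [W.w_trans, W.w_trans, W.w_symm]
  simp

theorem PF.IsH1.equiv [CommGroup A] {W : PF X A} (hW : W.IsH1) [PathConnectedSpace X] (x : X) :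
    Nonempty (Abelianization (FundamentalGroup X x) ≃* A) := by
  let f : Abelianization (FundamentalGroup X x) →* A := Abelianization.lift (W.toHom x)
  obtain ⟨h, hh⟩ := hW.2 (Abelianization (FundamentalGroup X x)) inferInstance
    (canon x (fun y => PathConnectedSpace.somePath x y) Abelianization.of)
  refine ⟨MulEquiv.ofBijective f ⟨?_, ?_⟩⟩
  · rw [injective_iff_map_eq_one]
    intro a ha
    induction a using QuotientGroup.induction_on with | H p =>
    induction p using Path.Homotopic.Quotient.ind with | mk p =>
    have h1 := hh x p
    rw [canon_loop] at h1
    have h2 : W.w p = 1 := ha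
    rw [h2, map_one, inv_eq_one] at h1
    exact h1
  · intro a
    obtain ⟨y, γ, hγ⟩ := hW.1 a
    obtain ⟨δ, hδ⟩ := W.exists_loop_at x γ
    exact ⟨Abelianization.of (Path.Homotopic.Quotient.mk δ : FundamentalGroup X x), hδ.trans hγ⟩

theorem exists_isH1_of_equiv [CommGroup A] [PathConnectedSpace X] (x0 : X)
    (φ : FundamentalGroup X x0 ≃* A) : ∃ W : PF X A, W.IsH1 := by
  refine ⟨canon x0 (fun y => PathConnectedSpace.somePath x0 y) φ.toMonoidHom, ?_, ?_⟩
  · intro a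
    obtain ⟨γ, hγ⟩ := Path.Homotopic.Quotient.mk_surjective (φ.symm a⁻¹)
    refine ⟨x0, γ, ?_⟩
    rw [canon_loop, hγ]
    simp
  · intro B _ W'
    refine ⟨(W'.toHom x0).comp (φ.symm.toMonoidHom.comp invMonoidHom), fun x γ => ?_⟩
    rw [canon_w]
    simp only [MonoidHom.comp_apply, invMonoidHom_apply, inv_inv]
    erw [MulEquiv.symm_apply_apply φ]
    rw [PF.toHom_mk, W'.w_trans, W'.w_trans, W'.w_symm]
    simp

theorem simplyConnected_of_cover {U V : Set X} (hU : IsOpen U) (hV : IsOpen V)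
    (hcov : ∀ x, x ∈ U ∨ x ∈ V) (pU : IsPathConnected U) (pV : IsPathConnected V)
    (pUV : IsPathConnected (U ∩ V))
    (h1 : ∀ (x : X) (γ : Path x x), (∀ t, γ t ∈ U) → γ.Homotopic (Path.refl x))
    (h2 : ∀ (x : X) (γ : Path x x), (∀ t, γ t ∈ V) → γ.Homotopic (Path.refl x)) :
    SimplyConnectedSpace X := by
  have huniv : U ∪ V = univ := eq_univ_of_forall hcov
  have : PathConnectedSpace X := by
    rw [pathConnectedSpace_iff_univ, ← huniv]
    exact pU.union pV pUV.nonempty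
  rw [simply_connected_iff_loops_nullhomotopic]
  refine ⟨this, fun x γ => ?_⟩
  let τ := fun y => PathConnectedSpace.somePath x y
  let W := canon x τ (MonoidHom.id _)
  have hW : ∀ (y : X) (δ : Path y y), δ.Homotopic (Path.refl y) → W.w δ = 1 := fun y δ h => by
    rw [W.w_hom h, W.w_refl]
  have h3 := W.loops_trivial hU hV hcov pU pV pUV (fun y δ h => hW y δ (h1 y δ h))
    (fun y δ h => hW y δ (h2 y δ h)) γ
  rw [canon_w, inv_eq_one] at h3
  let t : FundamentalGroup X x := Path.Homotopic.Quotient.mk (τ x)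
  let g : FundamentalGroup X x := Path.Homotopic.Quotient.mk γ
  have h4 : t⁻¹ * (g * t) = 1 := h3
  have h5 : g = 1 := by
    have : g = t * (t⁻¹ * (g * t)) * t⁻¹ := by group
    rw [this, h4]; group
  exact Path.Homotopic.Quotient.exact h5

end h1

end M3

namespace M3

section punct

variable {E : Type} [NormedAddCommGroup E] [NormedSpace ℝ E]

theorem zero_of_eq_neg {x : E} (h : x = -x) : x = 0 := by
  have h2 : (2 : ℝ) • x = 0 := by
    rw [two_smul]; nth_rewrite 1 [h]; simp
  simpa using h2

theorem not_neg_ray_iff {v : E} (hv : ‖v‖ = 1) (x : E) :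
    (x ≠ ‖x‖ • v) ∧ (x ≠ -(‖x‖ • v)) ↔ x ∉ Submodule.span ℝ {v} := by
  rw [Submodule.mem_span_singleton]
  constructor
  · rintro ⟨h1, h2⟩ ⟨a, rfl⟩
    rw [norm_smul, hv, mul_one, Real.norm_eq_abs] at h1 h2
    rcases le_total 0 a with h | h
    · rw [abs_of_nonneg h] at h1; exact h1 rfl
    · rw [abs_of_nonpos h] at h2; simp at h2
  · intro h
    exact ⟨fun h' => h ⟨_, h'.symm⟩, fun h' => h ⟨-‖x‖, by rw [neg_smul]; exact h'.symm⟩⟩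

theorem starConvex_ray {v : E} (hv : ‖v‖ = 1) : StarConvex ℝ (-v) {x : E | x ≠ ‖x‖ • v} := by
  rw [starConvex_iff_segment_subset]
  rintro y hy z ⟨a, b, ha, hb, hab, rfl⟩ hz
  set r := ‖a • -v + b • y‖ with hr
  have h0 : 0 ≤ r := norm_nonneg _
  rcases hb.eq_or_lt with rfl | hb'
  · have ha1 : a = 1 := by linarith
    subst ha1
    have h : ((r + 1) : ℝ) • v = 0 := by
      rw [add_smul, ← hz]; simp
    have : v ≠ 0 := by intro h; simp [h] at hv
    rcases smul_eq_zero.1 h with h | h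
    · linarith
    · exact this h
  · apply hy
    have h : b • y = (r + a) • v := by
      rw [add_smul, ← hz]; simp
    have h2 : y = ((r + a)/b) • v := by
      rw [div_eq_inv_mul, mul_smul, ← h, smul_smul, inv_mul_cancel₀ hb'.ne', one_smul]
    have h3 : ‖y‖ = (r+a)/b := by
      rw [h2, norm_smul, hv, mul_one, Real.norm_eq_abs, abs_of_nonneg (by positivity)]
    rw [h3]; exact h2

theorem simplyConnected_ray {v : E} (hv : ‖v‖ = 1) :
    SimplyConnectedSpace {x : E | x ≠ ‖x‖ • v} := by
  have hv0 : v ≠ 0 := by intro h; simp [h] at hv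
  have := (starConvex_ray hv).contractibleSpace ⟨-v, by
    simp only [mem_ofPred_eq, norm_neg, hv, one_smul]
    intro h
    exact hv0 (zero_of_eq_neg h.symm)⟩
  infer_instance

/-- A loop in a set over which a map from a simply connected space covers is null-homotopic. -/
theorem homotopic_refl_of_lift {X Y : Type} [TopologicalSpace X] [TopologicalSpace Y]
    [SimplyConnectedSpace Y] (j : C(Y, X)) {x : X} (γ : Path x x) {y : Y} (δ : Path y y)
    (h : ∀ t, j (δ t) = γ t) : γ.Homotopic (Path.refl x) := by
  have hx : x = j y := by have := h 0; simpa using this.symm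
  subst hx
  have h1 : γ = δ.map j.continuous := by ext t; exact (h t).symm
  have h2 : Path.refl (j y) = (Path.refl y).map j.continuous := by ext t; rfl
  rw [h1, h2]
  exact (SimplyConnectedSpace.paths_homotopic δ (Path.refl y)).map j

theorem loop_ray {v : E} (hv : ‖v‖ = 1) {x : {x : E // x ≠ 0}} (γ : Path x x)
    (h : ∀ t, (γ t : E) ≠ ‖(γ t : E)‖ • v) : γ.Homotopic (Path.refl x) := by
  have := simplyConnected_ray hv
  let j : C({x : E | x ≠ ‖x‖ • v}, {x : E // x ≠ 0}) :=
    ⟨fun y => ⟨y.1, fun h => y.2 (by simp [h])⟩, by fun_prop⟩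
  let δ : Path (⟨x.1, by simpa using h 0⟩ : {x : E | x ≠ ‖x‖ • v}) ⟨x.1, by simpa using h 0⟩ :=
    { toFun := fun t => ⟨(γ t).1, h t⟩
      continuous_toFun := by fun_prop
      source' := by simp
      target' := by simp }
  exact homotopic_refl_of_lift j γ δ (fun t => rfl)

theorem isPathConnected_ray {v : E} (hv : ‖v‖ = 1) :
    IsPathConnected {x : {x : E // x ≠ 0} | (x : E) ≠ ‖(x : E)‖ • v} := by
  have := simplyConnected_ray hv
  have h1 : IsPathConnected {x : E | x ≠ ‖x‖ • v} := isPathConnected_iff_pathConnectedSpace.2 inferInstance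
  have h2 := isPathConnected_range (X := {x : E | x ≠ ‖x‖ • v}) (Y := {x : E // x ≠ 0}) (f := fun y => ⟨y.1, fun h => y.2 (by simp [h])⟩) (by fun_prop)
  convert h2
  ext x
  constructor
  · intro h; exact ⟨⟨x.1, h⟩, rfl⟩
  · rintro ⟨y, rfl⟩; exact y.2

theorem simplyConnected_punctured (hE : Module.finrank ℝ E > 2) :
    SimplyConnectedSpace {x : E // x ≠ 0} := by
  have : FiniteDimensional ℝ E := Module.finite_of_finrank_pos (by omega)
  have : Nontrivial E := Module.nontrivial_of_finrank_pos (R := ℝ) (by omega)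
  obtain ⟨v, hv⟩ := exists_norm_eq E (zero_le_one)
  have hv' : ‖-v‖ = 1 := by simpa
  refine simplyConnected_of_cover (U := {x | (x : E) ≠ ‖(x : E)‖ • v})
    (V := {x | (x : E) ≠ ‖(x : E)‖ • (-v)}) ?_ ?_ ?_ (isPathConnected_ray hv)
    (isPathConnected_ray hv') ?_ ?_ ?_
  · exact isOpen_ne_fun (by fun_prop) (by fun_prop)
  · exact isOpen_ne_fun (by fun_prop) (by fun_prop)
  · rintro ⟨x, hx⟩
    by_contra! h
    simp only [mem_ofPred_eq, not_not] at h
    obtain ⟨h1, h2⟩ := h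
    apply hx
    have : x = -x := by
      conv_lhs => rw [h1]
      conv_rhs => rw [h2]
      simp
    exact zero_of_eq_neg this
  · have h1 : IsPathConnected ((Submodule.span ℝ {v} : Submodule ℝ E) : Set E)ᶜ := by
      apply isPathConnected_compl_of_one_lt_codim
      have := Submodule.finrank_quotient_add_finrank (Submodule.span ℝ {v})
      have h2 := finrank_span_le_card (R := ℝ) ({v} : Set E)
      simp at h2
      rw [← Module.finrank_eq_rank]
      exact_mod_cast (by omega : 1 < Module.finrank ℝ (E ⧸ Submodule.span ℝ {v}))
    have := isPathConnected_iff_pathConnectedSpace.1 h1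
    have h2 := isPathConnected_range (X := (((Submodule.span ℝ {v} : Submodule ℝ E) : Set E)ᶜ : Set E)) (Y := {x : E // x ≠ 0}) (f := fun y => ⟨y.1, fun h => y.2 (by simp [h])⟩) (by fun_prop)
    convert h2
    ext x
    have key := not_neg_ray_iff hv x.1
    simp only [mem_inter_iff, mem_ofPred_eq, smul_neg]
    rw [key]
    constructor
    · intro h; exact ⟨⟨x.1, h⟩, rfl⟩
    · rintro ⟨y, rfl⟩; exact y.2
  · intro x γ h; exact loop_ray hv γ h
  · intro x γ h; exact loop_ray hv' γ h

end punct

section sph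
variable {E : Type} [NormedAddCommGroup E] [InnerProductSpace ℝ E]

theorem simplyConnected_sphere (hE : Module.finrank ℝ E > 2) :
    SimplyConnectedSpace (Metric.sphere (0 : E) 1) := by
  have h1 := simplyConnected_punctured (E := E) hE
  have : FiniteDimensional ℝ E := Module.finite_of_finrank_pos (by omega)
  have hp : IsPathConnected (Metric.sphere (0 : E) 1) := by
    apply isPathConnected_sphere _ _ zero_le_one
    rw [← Module.finrank_eq_rank]
    exact_mod_cast (by omega : 1 < Module.finrank ℝ E)
  rw [simply_connected_iff_loops_nullhomotopic]
  refine ⟨isPathConnected_iff_pathConnectedSpace.1 hp, ?_⟩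
  intro x γ
  have hn : ∀ y : Metric.sphere (0 : E) 1, (y : E) ≠ 0 := by
    intro y h
    have := y.2
    simp [h] at this
  let i : C(Metric.sphere (0 : E) 1, {x : E // x ≠ 0}) := ⟨fun y => ⟨y.1, hn y⟩, by fun_prop⟩
  let j : C({x : E // x ≠ 0}, Metric.sphere (0 : E) 1) :=
    ⟨fun y => ⟨‖(y : E)‖⁻¹ • y.1, by
      have := norm_pos_iff.2 y.2
      simp [norm_smul, this.ne']⟩, by
      refine Continuous.subtype_mk ?_ _
      refine Continuous.smul (Continuous.inv₀ (by fun_prop) ?_) (by fun_prop)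
      intro y; simpa using y.2⟩
  refine homotopic_refl_of_lift j γ (γ.map i.continuous) ?_
  intro t
  apply Subtype.ext
  simp [i, j]

end sph

end M3

namespace M3

/-- Euclidean 3-space. -/
abbrev E3 : Type := EuclideanSpace ℝ (Fin 3)

/-- Every point is the centre of an open embedding of Euclidean 3-space. -/
def LocE (X : Type) [TopologicalSpace X] : Prop :=
  ∀ x : X, ∃ e : E3 → X, IsOpenEmbedding e ∧ e 0 = x

section loce
variable {X Y : Type} [TopologicalSpace X] [TopologicalSpace Y]

theorem locE_of_chart (h : ∀ x : X, ∃ φ : OpenPartialHomeomorph X E3, x ∈ φ.source) : LocE X := by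
  intro x
  obtain ⟨φ, hx⟩ := h x
  obtain ⟨r, hr, hb⟩ := Metric.isOpen_iff.1 φ.open_target (φ x) (φ.map_source hx)
  let ψ := (OpenPartialHomeomorph.univBall (φ x) r).trans φ.symm
  have hs : ψ.source = univ := by
    apply eq_univ_of_forall
    intro y
    rw [OpenPartialHomeomorph.trans_source, OpenPartialHomeomorph.univBall_source]
    refine ⟨mem_univ _, hb ?_⟩
    rw [← OpenPartialHomeomorph.univBall_target _ hr]
    apply OpenPartialHomeomorph.map_source
    simp [OpenPartialHomeomorph.univBall_source]
  refine ⟨ψ, ψ.isOpenEmbedding hs, ?_⟩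
  simp [ψ, OpenPartialHomeomorph.univBall_apply_zero, hx]

theorem LocE.exists_chart (h : LocE X) (x : X) :
    ∃ φ : OpenPartialHomeomorph X E3, x ∈ φ.source := by
  obtain ⟨e, he, rfl⟩ := h x
  exact ⟨(he.toOpenPartialHomeomorph e).symm, by simp⟩

/-- The charted space structure from `LocE`. -/
@[reducible] def LocE.charted (h : LocE X) : ChartedSpace E3 X where
  atlas := univ
  chartAt x := (h.exists_chart x).choose
  mem_chart_source x := (h.exists_chart x).choose_spec
  chart_mem_atlas _ := mem_univ _

theorem locE_of_charted [ChartedSpace E3 X] : LocE X :=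
  locE_of_chart fun x => ⟨chartAt E3 x, mem_chart_source E3 x⟩

theorem LocE.locallyPathConnectedSpace (h : LocE X) : LocallyPathConnectedSpace X :=
  have := h.charted
  ChartedSpace.locallyPathConnectedSpace E3 X

theorem LocE.of_isLocalHomeomorph (h : LocE X) {f : X → Y} (hf : IsLocalHomeomorph f)
    (hs : Function.Surjective f) : LocE Y := by
  apply locE_of_chart
  intro y
  obtain ⟨x, rfl⟩ := hs y
  obtain ⟨φ, hx, hφ⟩ := hf x
  obtain ⟨ψ, hψ⟩ := h.exists_chart x
  refine ⟨φ.symm.trans ψ, ?_⟩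
  rw [hφ]
  simp [hx, hψ]

theorem LocE.isOpen_subtype (h : LocE X) {U : Set X} (hU : IsOpen U) : LocE U := by
  have := h.charted
  exact @locE_of_charted _ _ (TopologicalSpace.Opens.instChartedSpace (H := E3) (M := X) (s := ⟨U, hU⟩))

theorem locE_of_cover {ι : Type} (Z : ι → Type) [∀ i, TopologicalSpace (Z i)] (h : ∀ i, LocE (Z i))
    (j : ∀ i, Z i → X) (hj : ∀ i, IsOpenEmbedding (j i)) (hs : ∀ x, ∃ i, x ∈ range (j i)) :
    LocE X := by
  intro x
  obtain ⟨i, z, rfl⟩ := hs x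
  obtain ⟨e, he, rfl⟩ := h i z
  exact ⟨j i ∘ e, (hj i).comp he, rfl⟩

end loce

section puncture

variable {M : Type} [TopologicalSpace M] [T2Space M] {A B : Type}

theorem simplyConnected_E3_punct : SimplyConnectedSpace {x : E3 // x ≠ 0} :=
  simplyConnected_punctured (by simp)

/-- A lift of a path along an embedding -/
theorem exists_path_lift {X Y : Type} [TopologicalSpace X] [TopologicalSpace Y] {e : Y → X}
    (he : IsEmbedding e) {a b : X} (γ : Path a b) (h : ∀ t, γ t ∈ range e) :
    ∃ (a' b' : Y) (δ : Path a' b'), ∀ t, e (δ t) = γ t := by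
  choose d hd using h
  have hc : Continuous d := by
    rw [he.continuous_iff]
    convert γ.continuous using 1
    ext t; exact hd t
  exact ⟨d 0, d 1, ⟨⟨d, hc⟩, rfl, rfl⟩, hd⟩

/-- A lift of a loop along an embedding -/
theorem exists_loop_lift {X Y : Type} [TopologicalSpace X] [TopologicalSpace Y] {e : Y → X}
    (he : IsEmbedding e) {a : X} (γ : Path a a) (h : ∀ t, γ t ∈ range e) :
    ∃ (a' : Y) (δ : Path a' a'), ∀ t, e (δ t) = γ t := by
  obtain ⟨a', b', δ, h⟩ := exists_path_lift he γ h
  have : a' = b' := by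
    apply he.injective
    have h0 := h 0
    have h1 := h 1
    simp at h0 h1
    rw [h0, h1]
  subst this
  exact ⟨a', δ, h⟩

theorem PF.loop_of_lift [Group A] {X Y : Type} [TopologicalSpace X] [TopologicalSpace Y]
    [SimplyConnectedSpace Y] (W : PF X A) {e : Y → X}
    (he : IsEmbedding e) {a : X} (γ : Path a a) (h : ∀ t, γ t ∈ range e) : W.w γ = 1 := by
  obtain ⟨a', δ, h⟩ := exists_loop_lift he γ h
  rw [W.w_hom (homotopic_refl_of_lift ⟨e, he.continuous⟩ γ δ h), W.w_refl]

variable {e : E3 → M} (he : IsOpenEmbedding e)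
include he

theorem punct_inter : {m : M | m ≠ e 0} ∩ range e = range (fun x : {x : E3 // x ≠ 0} => e x) := by
  ext m
  constructor
  · rintro ⟨h, x, rfl⟩
    exact ⟨⟨x, fun h' => h (by rw [h'])⟩, rfl⟩
  · rintro ⟨x, rfl⟩
    exact ⟨fun h => x.2 (he.injective h), mem_range_self _⟩

theorem punct_isPathConnected_inter : IsPathConnected ({m : M | m ≠ e 0} ∩ range e) := by
  have := simplyConnected_E3_punct
  rw [punct_inter he]
  exact isPathConnected_range (he.continuous.comp continuous_subtype_val)

theorem punct_isPathConnected [PathConnectedSpace M] (hM : LocE M) :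
    IsPathConnected {m : M | m ≠ e 0} := by
  have := hM.locallyPathConnectedSpace
  have hU : IsOpen {m : M | m ≠ e 0} := isOpen_ne
  have hV : IsOpen (range e) := he.isOpen_range
  rw [← hU.isConnected_iff_isPathConnected]
  have pUV := (punct_isPathConnected_inter he).isConnected
  refine ⟨pUV.nonempty.mono inter_subset_left, ?_⟩
  -- any two disjoint open sets covering: the one missing the collar is clopen in M
  rw [isPreconnected_iff_subset_of_disjoint]
  intro u v hu hv hcov hdis
  have key : ∀ u v : Set M, IsOpen u → IsOpen v → {m : M | m ≠ e 0} ⊆ u ∪ v →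
      {m : M | m ≠ e 0} ∩ (u ∩ v) = ∅ → {m : M | m ≠ e 0} ∩ range e ⊆ u →
      {m : M | m ≠ e 0} ⊆ u := by
    intro u v hu hv hcov hdis h
    have hc : IsClopen (v ∩ {m | m ≠ e 0}) := by
      refine ⟨?_, hv.inter hU⟩
      have : v ∩ {m | m ≠ e 0} = (u ∪ range e)ᶜ := by
        ext m
        constructor
        · rintro ⟨h1, h2⟩ h3
          have h4 : m ∈ u := by
            rcases h3 with h3 | h3
            · exact h3
            · exact h ⟨h2, h3⟩
          exact (hdis.subset ⟨h2, h4, h1⟩ : m ∈ (∅ : Set M))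
        · intro h3
          have h4 : m ≠ e 0 := fun h5 => h3 (Or.inr ⟨0, h5.symm⟩)
          rcases hcov h4 with h5 | h5
          · exact absurd (Or.inl h5) h3
          · exact ⟨h5, h4⟩
      rw [this]
      exact (hu.union hV).isClosed_compl
    rcases isClopen_iff.1 hc with h1 | h1
    · intro m hm
      rcases hcov hm with h2 | h2
      · exact h2
      · exact absurd (h1.subset ⟨h2, hm⟩) (notMem_empty _)
    · exact absurd rfl (h1.superset (mem_univ (e 0))).2
  have hsub := pUV.isPreconnected
  rw [isPreconnected_iff_subset_of_disjoint] at hsub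
  rcases hsub u v hu hv (inter_subset_left.trans hcov)
    (subset_empty_iff.1 (fun m hm => hdis.subset ⟨hm.1.1, hm.2⟩)) with h | h
  · exact Or.inl (key u v hu hv hcov hdis h)
  · exact Or.inr (key v u hv hu (by rwa [union_comm]) (by rwa [inter_comm v u]) h)

end puncture

end M3

namespace M3

section puncture2

variable {M : Type} [TopologicalSpace M] [T2Space M] {A B : Type}

/-- change of gauge -/
def PF.gauge [CommGroup B] (W : PF M B) (u : M → B) : PF M B where
  w {x y} γ := u x * W.w γ * (u y)⁻¹
  w_trans {x y z} γ δ := by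
    rw [W.w_trans]; group
  w_hom h := by rw [W.w_hom h]

theorem PF.gauge_loop [CommGroup B] (W : PF M B) (u : M → B) {x : M} (γ : Path x x) :
    (W.gauge u).w γ = W.w γ := by
  change u x * W.w γ * (u x)⁻¹ = W.w γ
  rw [mul_comm (u x)]; group

variable {e : E3 → M} (he : IsOpenEmbedding e)
include he

theorem punct_isH1 [PathConnectedSpace M] (hM : LocE M) [CommGroup A] {W : PF M A} (hW : W.IsH1) :
    (W.comap (⟨Subtype.val, continuous_subtype_val⟩ : C({m : M | m ≠ e 0}, M))).IsH1 := by
  have hU : IsOpen {m : M | m ≠ e 0} := isOpen_ne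
  have hV : IsOpen (range e) := he.isOpen_range
  have pU := punct_isPathConnected he hM
  have hcov : ∀ x, x ∈ {m : M | m ≠ e 0} ∨ x ∈ range e := by
    intro x
    by_cases h : x = e 0
    · exact Or.inr ⟨0, h.symm⟩
    · exact Or.inl h
  have := isPathConnected_iff_pathConnectedSpace.1 pU
  have := simplyConnected_E3_punct
  set W1 := (W.comap (⟨Subtype.val, continuous_subtype_val⟩ : C({m : M | m ≠ e 0}, M))) with hW1
  obtain ⟨u0⟩ : Nonempty {m : M | m ≠ e 0} := inferInstance
  constructor
  · intro a
    let S := (W1.toHom u0).range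
    have key : ∀ x (γ : Path x x), (W.push (QuotientGroup.mk' S)).w γ = 1 := by
      intro x γ
      refine PF.loops_trivial hU hV hcov pU (isPathConnected_range he.continuous)
        (punct_isPathConnected_inter he) _ ?_ ?_ γ
      · intro x γ h
        obtain ⟨x', δ, hδ⟩ := exists_loop_lift (e := (Subtype.val : {m : M | m ≠ e 0} → M))
          IsEmbedding.subtypeVal γ (by simpa using h)
        obtain ⟨δ', hδ'⟩ := W1.exists_loop_at u0 δ
        change QuotientGroup.mk' S (W.w γ) = 1
        rw [QuotientGroup.mk'_apply, QuotientGroup.eq_one_iff]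
        refine ⟨Path.Homotopic.Quotient.mk δ', ?_⟩
        have h1 : W.w γ = W1.w δ := W.w_congr _ _ (fun t => (hδ t).symm)
        rw [h1, ← hδ']
        exact W1.toHom_mk u0 δ'
      · intro x γ h
        exact PF.loop_of_lift _ he.isEmbedding γ h
    obtain ⟨x, γ, rfl⟩ := hW.1 a
    have h := key x γ
    change QuotientGroup.mk' S (W.w γ) = 1 at h
    rw [QuotientGroup.mk'_apply, QuotientGroup.eq_one_iff] at h
    obtain ⟨g, hg⟩ := h
    induction g using Quotient.inductionOn with
    | _ δ => exact ⟨u0, δ, hg⟩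
  · intro B _ W2
    let ι : {x : E3 // x ≠ 0} → {m : M | m ≠ e 0} :=
      fun x => ⟨e x, fun h => x.2 (he.injective h)⟩
    have hι : IsEmbedding ι := by
      have : IsEmbedding (Subtype.val ∘ ι) := he.isEmbedding.comp IsEmbedding.subtypeVal
      exact this.of_comp (by
        refine Continuous.subtype_mk (he.continuous.comp continuous_subtype_val) _)
          continuous_subtype_val
    obtain ⟨u, hu⟩ := (W2.comap ⟨ι, hι.continuous⟩).exists_pot
    let u' : {m : M | m ≠ e 0} → B := Function.extend ι u 1
    have hu' : ∀ x, u' (ι x) = u x := fun x => hι.injective.extend_apply _ _ _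
    obtain ⟨W', hW'⟩ := PF.exists_extension hU hV hcov (W2.gauge u') (by
      intro x y γ hγ
      obtain ⟨a, b, δ, hδ⟩ := exists_path_lift hι γ (by
        intro t
        obtain ⟨z, hz⟩ := hγ t
        refine ⟨⟨z, ?_⟩, Subtype.ext hz⟩
        rintro rfl
        exact (γ t).2 hz.symm)
      have h1 : W2.w γ = (u a)⁻¹ * u b := by
        rw [← hu δ]
        exact W2.w_congr _ _ (fun t => (hδ t).symm)
      have hx : x = ι a := by have := hδ 0; simpa using this.symm
      have hy : y = ι b := by have := hδ 1; simpa using this.symm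
      change u' x * W2.w γ * (u' y)⁻¹ = 1
      rw [h1, hx, hy, hu', hu']; group)
    obtain ⟨h, hh⟩ := hW.2 B _ W'
    refine ⟨h, fun x γ => ?_⟩
    rw [← W2.gauge_loop u' γ, ← hW', hh]
    rfl

end puncture2

end M3

namespace M3

/-- radial inversion of the punctured unit ball, extended by zero -/
def rinv (x : E3) : E3 := (max (1 - ‖x‖) 0 / ‖x‖) • x

theorem rinv_zero : rinv 0 = 0 := by simp [rinv]

theorem rinv_of_one_le {x : E3} (h : 1 ≤ ‖x‖) : rinv x = 0 := by
  simp [rinv, max_eq_right (sub_nonpos.2 h)]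

theorem norm_rinv {x : E3} (h0 : x ≠ 0) (h1 : ‖x‖ < 1) : ‖rinv x‖ = 1 - ‖x‖ := by
  have := norm_pos_iff.2 h0
  rw [rinv, norm_smul, max_eq_left (sub_nonneg.2 h1.le), Real.norm_eq_abs,
    abs_of_nonneg (div_nonneg (sub_nonneg.2 h1.le) this.le), div_mul_cancel₀ _ this.ne']

theorem rinv_rinv {x : E3} (h0 : x ≠ 0) (h1 : ‖x‖ < 1) : rinv (rinv x) = x := by
  have := norm_pos_iff.2 h0
  have h2 : 1 - ‖x‖ ≠ 0 := by linarith
  nth_rewrite 1 [rinv]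
  rw [norm_rinv h0 h1, rinv, smul_smul, max_eq_left (sub_nonneg.2 h1.le), max_eq_left (by linarith)]
  convert one_smul ℝ x
  field_simp
  ring

theorem continuousAt_rinv {x : E3} (h0 : x ≠ 0) : ContinuousAt rinv x := by
  unfold rinv
  have h1 : ContinuousAt (fun x : E3 => max (1 - ‖x‖) 0 / ‖x‖) x :=
    ContinuousAt.div (by fun_prop) (by fun_prop) (by simpa)
  exact h1.smul continuousAt_id

section glue

variable {M N : Type} [TopologicalSpace M] [TopologicalSpace N] [T2Space M] [T2Space N]

/-- the collapsing map -/
def col (e : E3 → M) (f : E3 → N) (m : M) : N := f (Function.extend e rinv (fun _ => 0) m)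

variable {e : E3 → M} (he : IsOpenEmbedding e) {f : E3 → N} (hf : IsOpenEmbedding f)

theorem col_mem (m : M) : col e f m ∈ range f := ⟨_, rfl⟩

include he

theorem col_apply (x : E3) : col e f (e x) = f (rinv x) := by
  rw [col, he.injective.extend_apply]

theorem col_off {m : M} (h : m ∉ e '' Metric.closedBall 0 1) : col e f m = f 0 := by
  by_cases hm : ∃ x, e x = m
  · obtain ⟨x, rfl⟩ := hm
    rw [col_apply he, rinv_of_one_le]
    by_contra! h1
    exact h ⟨x, by simpa using h1.le, rfl⟩
  · rw [col, Function.extend_apply' _ _ _ hm]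

include hf

theorem continuousAt_col {m : M} (h : m ≠ e 0) : ContinuousAt (col e f) m := by
  by_cases hm : m ∈ range e
  · obtain ⟨x, rfl⟩ := hm
    have hx : x ≠ 0 := fun h' => h (by rw [h'])
    rw [← he.continuousAt_iff]
    have : col e f ∘ e = f ∘ rinv := by ext x; exact col_apply he x
    rw [this]
    exact hf.continuous.continuousAt.comp (continuousAt_rinv hx)
  · have hc : IsOpen (e '' Metric.closedBall 0 1)ᶜ :=
      ((isCompact_closedBall (0 : E3) 1).image he.continuous).isClosed.isOpen_compl
    have : col e f =ᶠ[𝓝 m] fun _ => f 0 := by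
      filter_upwards [hc.mem_nhds (fun h => hm (image_subset_range _ _ h))] with y hy
      exact col_off he hy
    exact continuousAt_const.congr this.symm

theorem col_ne {m : M} (h1 : m ≠ e 0) (h2 : col e f m ≠ f 0) :
    ∃ x, x ≠ 0 ∧ ‖x‖ < 1 ∧ e x = m := by
  by_contra! h
  apply h2
  apply col_off he
  rintro ⟨x, hx, rfl⟩
  have hx0 : x ≠ 0 := fun h' => h1 (by rw [h'])
  rcases (mem_closedBall_zero_iff.1 hx).lt_or_eq with h3 | h3
  · exact h x hx0 h3 rfl
  · apply h2
    rw [col_apply he, rinv_of_one_le h3.ge]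

theorem col_col {m : M} (h1 : m ≠ e 0) (h2 : col e f m ≠ f 0) : col f e (col e f m) = m := by
  obtain ⟨x, h3, h4, rfl⟩ := col_ne he hf h1 h2
  rw [col_apply he, col_apply hf, rinv_rinv h3 h4]

end glue

section csum

variable {M N : Type} [TopologicalSpace M] [TopologicalSpace N] [T2Space M] [T2Space N]

/-- the connected sum, as a subset of the product -/
def CS (e : E3 → M) (f : E3 → N) : Set (M × N) :=
  {p | (p.1 ≠ e 0 ∧ p.2 = col e f p.1) ∨ (p.2 ≠ f 0 ∧ p.1 = col f e p.2)}

variable {e : E3 → M} (he : IsOpenEmbedding e) {f : E3 → N} (hf : IsOpenEmbedding f)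

/-- first inclusion -/
def iU (e : E3 → M) (f : E3 → N) (m : {m : M | m ≠ e 0}) : CS e f :=
  ⟨(m.1, col e f m.1), Or.inl ⟨m.2, rfl⟩⟩

/-- second inclusion -/
def iV (e : E3 → M) (f : E3 → N) (n : {n : N | n ≠ f 0}) : CS e f :=
  ⟨(col f e n.1, n.1), Or.inr ⟨n.2, rfl⟩⟩

/-- first open set -/
def sU (e : E3 → M) (f : E3 → N) : Set (CS e f) := {p | p.1.1 ≠ e 0}

/-- second open set -/
def sV (e : E3 → M) (f : E3 → N) : Set (CS e f) := {p | p.1.2 ≠ f 0}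

theorem cs_cov (p : CS e f) : p ∈ sU e f ∨ p ∈ sV e f := by
  rcases p.2 with h | h
  · exact Or.inl h.1
  · exact Or.inr h.1

theorem isOpen_sU : IsOpen (sU e f) :=
  isOpen_ne_fun (continuous_fst.comp continuous_subtype_val) continuous_const

theorem isOpen_sV : IsOpen (sV e f) :=
  isOpen_ne_fun (continuous_snd.comp continuous_subtype_val) continuous_const

include he hf

theorem sU_snd {p : CS e f} (h : p ∈ sU e f) : p.1.2 = col e f p.1.1 := by
  rcases p.2 with h1 | ⟨h1, h2⟩
  · exact h1.2
  · have h3 : col f e p.1.2 ≠ e 0 := by rw [← h2]; exact h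
    rw [h2, col_col hf he h1 h3]

theorem sV_fst {p : CS e f} (h : p ∈ sV e f) : p.1.1 = col f e p.1.2 := by
  rcases p.2 with ⟨h1, h2⟩ | h1
  · have h3 : col e f p.1.1 ≠ f 0 := by rw [← h2]; exact h
    rw [h2, col_col he hf h1 h3]
  · exact h1.2

theorem range_iU : range (iU e f) = sU e f := by
  ext p
  constructor
  · rintro ⟨m, rfl⟩; exact m.2
  · intro h
    refine ⟨⟨p.1.1, h⟩, Subtype.ext (Prod.ext rfl ?_)⟩
    exact (sU_snd he hf h).symm

theorem range_iV : range (iV e f) = sV e f := by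
  ext p
  constructor
  · rintro ⟨m, rfl⟩; exact m.2
  · intro h
    refine ⟨⟨p.1.2, h⟩, Subtype.ext (Prod.ext ?_ rfl)⟩
    exact (sV_fst he hf h).symm

theorem continuous_col_sub : Continuous (fun m : {m : M | m ≠ e 0} => col e f m.1) :=
  continuous_iff_continuousAt.2 fun m =>
    (continuousAt_col he hf m.2).comp continuous_subtype_val.continuousAt

theorem iU_cont : Continuous (iU e f) :=
  (continuous_subtype_val.prodMk (continuous_col_sub he hf)).subtype_mk _

theorem iV_cont : Continuous (iV e f) :=
  ((continuous_col_sub hf he).prodMk continuous_subtype_val).subtype_mk _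

theorem iU_emb : IsOpenEmbedding (iU e f) := by
  refine ⟨?_, by rw [range_iU he hf]; exact isOpen_sU⟩
  exact IsEmbedding.of_comp (iU_cont he hf) (g := fun p : CS e f => p.1.1) (by fun_prop)
    IsEmbedding.subtypeVal

theorem iV_emb : IsOpenEmbedding (iV e f) := by
  refine ⟨?_, by rw [range_iV he hf]; exact isOpen_sV⟩
  exact IsEmbedding.of_comp (iV_cont he hf) (g := fun p : CS e f => p.1.2) (by fun_prop)
    IsEmbedding.subtypeVal

theorem cs_locE (hM : LocE M) (hN : LocE N) : LocE (CS e f) := by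
  intro p
  rcases cs_cov p with h | h
  · rw [← range_iU he hf] at h
    obtain ⟨m, rfl⟩ := h
    obtain ⟨j, hj, rfl⟩ := hM.isOpen_subtype (U := {m : M | m ≠ e 0}) isOpen_ne m
    exact ⟨_, (iU_emb he hf).comp hj, rfl⟩
  · rw [← range_iV he hf] at h
    obtain ⟨m, rfl⟩ := h
    obtain ⟨j, hj, rfl⟩ := hN.isOpen_subtype (U := {m : N | m ≠ f 0}) isOpen_ne m
    exact ⟨_, (iV_emb he hf).comp hj, rfl⟩

theorem cs_compact [CompactSpace M] [CompactSpace N] : CompactSpace (CS e f) := by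
  rw [← isCompact_iff_compactSpace]
  have h1 : ∀ {m}, m ∈ (e '' Metric.ball 0 (1/2))ᶜ → m ≠ e 0 := by
    rintro m hm rfl
    exact hm ⟨0, by simp, rfl⟩
  have h2 : ∀ {n}, n ∈ (f '' Metric.ball 0 (1/2))ᶜ → n ≠ f 0 := by
    rintro m hm rfl
    exact hm ⟨0, by simp, rfl⟩
  have c1 : IsCompact ((fun m => (m, col e f m)) '' (e '' Metric.ball 0 (1/2))ᶜ) := by
    apply ((he.isOpenMap _ Metric.isOpen_ball).isClosed_compl.isCompact).image_of_continuousOn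
    intro m hm
    exact (continuousAt_id.prodMk (continuousAt_col he hf (h1 hm))).continuousWithinAt
  have c2 : IsCompact ((fun n => (col f e n, n)) '' (f '' Metric.ball 0 (1/2))ᶜ) := by
    apply ((hf.isOpenMap _ Metric.isOpen_ball).isClosed_compl.isCompact).image_of_continuousOn
    intro m hm
    exact ((continuousAt_col hf he (h2 hm)).prodMk continuousAt_id).continuousWithinAt
  convert c1.union c2
  ext ⟨m, n⟩
  constructor
  · rintro (⟨h3, h4⟩ | ⟨h3, h4⟩)
    · simp only at h3 h4
      subst h4
      by_cases hm : m ∈ e '' Metric.ball 0 (1/2)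
      · right
        obtain ⟨x, hx, rfl⟩ := hm
        have hx' := mem_ball_zero_iff.1 hx
        have hx0 : x ≠ 0 := fun h' => h3 (by rw [h'])
        refine ⟨_, ?_, Prod.ext ?_ rfl⟩
        · simp only [col_apply he]
          rintro ⟨y, hy, h⟩
          have := hf.injective h
          subst this
          have := mem_ball_zero_iff.1 hy
          rw [norm_rinv hx0 (by linarith)] at this
          linarith
        · simp only [col_apply he, col_apply hf]
          rw [rinv_rinv hx0 (by linarith)]
      · exact Or.inl ⟨m, hm, rfl⟩
    · simp only at h3 h4
      subst h4
      by_cases hm : n ∈ f '' Metric.ball 0 (1/2)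
      · left
        obtain ⟨x, hx, rfl⟩ := hm
        have hx' := mem_ball_zero_iff.1 hx
        have hx0 : x ≠ 0 := fun h' => h3 (by rw [h'])
        refine ⟨_, ?_, Prod.ext rfl ?_⟩
        · simp only [col_apply hf]
          rintro ⟨y, hy, h⟩
          have := he.injective h
          subst this
          have := mem_ball_zero_iff.1 hy
          rw [norm_rinv hx0 (by linarith)] at this
          linarith
        · simp only [col_apply he, col_apply hf]
          rw [rinv_rinv hx0 (by linarith)]
      · exact Or.inr ⟨n, hm, rfl⟩
  · rintro (⟨m, hm, h⟩ | ⟨m, hm, h⟩)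
    · cases h
      exact Or.inl ⟨h1 hm, rfl⟩
    · cases h
      exact Or.inr ⟨h2 hm, rfl⟩

theorem cs_pU [PathConnectedSpace M] (hM : LocE M) : IsPathConnected (sU e f) := by
  have := isPathConnected_iff_pathConnectedSpace.1 (punct_isPathConnected he hM)
  rw [← range_iU he hf]
  exact isPathConnected_range (iU_cont he hf)

theorem cs_pV [PathConnectedSpace N] (hN : LocE N) : IsPathConnected (sV e f) := by
  have := isPathConnected_iff_pathConnectedSpace.1 (punct_isPathConnected hf hN)
  rw [← range_iV he hf]
  exact isPathConnected_range (iV_cont he hf)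

theorem cs_pUV : IsPathConnected (sU e f ∩ sV e f) := by
  have := simplyConnected_E3_punct
  let φ := OpenPartialHomeomorph.univBall (0 : E3) 1
  have h0 : φ 0 = 0 := OpenPartialHomeomorph.univBall_apply_zero _ _
  have hs : φ.source = univ := OpenPartialHomeomorph.univBall_source _ _
  have ht : φ.target = Metric.ball 0 1 := OpenPartialHomeomorph.univBall_target _ zero_lt_one
  have hφ := φ.isOpenEmbedding hs
  have hne : ∀ x : {x : E3 // x ≠ 0}, φ x ≠ 0 := fun x h => x.2 (hφ.injective (by rw [h, h0]))
  have hlt : ∀ x, ‖φ x‖ < 1 := fun x => by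
    rw [← mem_ball_zero_iff, ← ht]
    exact φ.map_source (by rw [hs]; trivial)
  let F : {x : E3 // x ≠ 0} → CS e f := fun x =>
    iU e f ⟨e (φ x), fun h => hne x (he.injective h)⟩
  have hF : Continuous F := (iU_cont he hf).comp
    ((he.continuous.comp (hφ.continuous.comp continuous_subtype_val)).subtype_mk _)
  convert isPathConnected_range hF
  ext p
  constructor
  · rintro ⟨h1, h2⟩
    rw [← range_iU he hf] at h1
    obtain ⟨⟨m, hm⟩, rfl⟩ := h1
    obtain ⟨x, hx0, hx1, rfl⟩ := col_ne he hf hm h2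
    have hxt : x ∈ φ.target := by rw [ht]; simpa using hx1
    refine ⟨⟨φ.symm x, ?_⟩, ?_⟩
    · intro h
      have := φ.right_inv hxt
      rw [h, h0] at this
      exact hx0 this.symm
    · simp only [F]
      congr 2
      rw [φ.right_inv hxt]
  · rintro ⟨x, rfl⟩
    refine ⟨fun h => hne x (he.injective h), ?_⟩
    intro h
    have h' : col e f (e (φ x)) = f 0 := h
    rw [col_apply he] at h'
    have := hf.injective h'
    have h3 := norm_rinv (hne x) (hlt x)
    rw [this, norm_zero] at h3
    linarith [hlt x]

theorem cs_pathConnected [PathConnectedSpace M] [PathConnectedSpace N] (hM : LocE M)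
    (hN : LocE N) : PathConnectedSpace (CS e f) := by
  rw [pathConnectedSpace_iff_univ, ← eq_univ_of_forall (s := sU e f ∪ sV e f) cs_cov]
  exact (cs_pU he hf hM).union (cs_pV he hf hN) (cs_pUV he hf).nonempty

end csum

section csH1

variable {M N : Type} [TopologicalSpace M] [TopologicalSpace N] [T2Space M] [T2Space N]
  {A B : Type} [CommGroup A] [CommGroup B]

/-- product functional on the connected sum -/
def csW (e : E3 → M) (f : E3 → N) (WM : PF M A) (WN : PF N B) : PF (CS e f) (A × B) where
  w γ := (WM.w (γ.map (continuous_fst.comp continuous_subtype_val)),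
    WN.w (γ.map (continuous_snd.comp continuous_subtype_val)))
  w_trans γ δ := by
    rw [Path.map_trans, Path.map_trans, WM.w_trans, WN.w_trans]; rfl
  w_hom h := Prod.ext (WM.w_hom (h.map ⟨_, continuous_fst.comp continuous_subtype_val⟩))
    (WN.w_hom (h.map ⟨_, continuous_snd.comp continuous_subtype_val⟩))

variable {e : E3 → M} (he : IsOpenEmbedding e) {f : E3 → N} (hf : IsOpenEmbedding f)
include he hf

theorem csW_iU (WM : PF M A) (WN : PF N B) {m : {m : M | m ≠ e 0}} (γ : Path m m) :
    (csW e f WM WN).w (γ.map (iU_cont he hf)) =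
      ((WM.comap (⟨Subtype.val, continuous_subtype_val⟩ : C({m : M | m ≠ e 0}, M))).w γ, 1) := by
  refine Prod.ext rfl ?_
  exact PF.loop_of_lift WN hf.isEmbedding _ (fun t => col_mem _)

theorem csW_iV (WM : PF M A) (WN : PF N B) {m : {m : N | m ≠ f 0}} (γ : Path m m) :
    (csW e f WM WN).w (γ.map (iV_cont he hf)) =
      (1, (WN.comap (⟨Subtype.val, continuous_subtype_val⟩ : C({m : N | m ≠ f 0}, N))).w γ) := by
  refine Prod.ext ?_ rfl
  exact PF.loop_of_lift WM he.isEmbedding _ (fun t => col_mem _)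

theorem csW_isH1 [PathConnectedSpace M] [PathConnectedSpace N] (hM : LocE M)
    (hN : LocE N) {WM : PF M A} {WN : PF N B} (hWM : WM.IsH1) (hWN : WN.IsH1) :
    (csW e f WM WN).IsH1 := by
  have h1 := punct_isH1 he hM hWM
  have h2 := punct_isH1 hf hN hWN
  have := cs_pathConnected he hf hM hN
  constructor
  · rintro ⟨a, b⟩
    obtain ⟨x, γ, hγ⟩ := h1.1 a
    obtain ⟨y, δ, hδ⟩ := h2.1 b
    obtain ⟨δ', hδ'⟩ := (csW e f WM WN).exists_loop_at (iU e f x) (δ.map (iV_cont he hf))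
    refine ⟨iU e f x, (γ.map (iU_cont he hf)).trans δ', ?_⟩
    rw [PF.w_trans, hδ', csW_iU he hf, csW_iV he hf, hγ, hδ]
    simp
  · intro C _ W'
    obtain ⟨kA, hkA⟩ := h1.2 C _ (W'.comap ⟨_, iU_cont he hf⟩)
    obtain ⟨kB, hkB⟩ := h2.2 C _ (W'.comap ⟨_, iV_cont he hf⟩)
    refine ⟨kA.coprod kB, ?_⟩
    let D : PF (CS e f) C :=
      { w := fun γ => W'.w γ * (kA.coprod kB ((csW e f WM WN).w γ))⁻¹
        w_trans := fun γ δ => by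
          rw [W'.w_trans, PF.w_trans, map_mul, mul_inv]
          exact mul_mul_mul_comm _ _ _ _
        w_hom := fun h => by rw [W'.w_hom h, PF.w_hom _ h] }
    intro x γ
    have key : D.w γ = 1 := by
      refine D.loops_trivial isOpen_sU isOpen_sV cs_cov (cs_pU he hf hM) (cs_pV he hf hN)
        (cs_pUV he hf) ?_ ?_ γ
      · intro x γ h
        obtain ⟨m, δ, hδ⟩ := exists_loop_lift (iU_emb he hf).isEmbedding γ (by
          rw [range_iU he hf]; exact h)
        rw [D.w_congr γ (δ.map (iU_cont he hf)) (fun t => (hδ t).symm)]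
        change W'.w _ * (kA.coprod kB _)⁻¹ = 1
        rw [csW_iU he hf, MonoidHom.coprod_apply, map_one, mul_one, ← hkA, mul_inv_eq_one]
        rfl
      · intro x γ h
        obtain ⟨m, δ, hδ⟩ := exists_loop_lift (iV_emb he hf).isEmbedding γ (by
          rw [range_iV he hf]; exact h)
        rw [D.w_congr γ (δ.map (iV_cont he hf)) (fun t => (hδ t).symm)]
        change W'.w _ * (kA.coprod kB _)⁻¹ = 1
        rw [csW_iV he hf, MonoidHom.coprod_apply, map_one, one_mul, ← hkB, mul_inv_eq_one]
        rfl
    exact mul_inv_eq_one.1 key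

end csH1

end M3

namespace M3

/-- `A` is the abelianised fundamental group of a closed connected 3-manifold. -/
def Real3 (A : Type) [CommGroup A] : Prop :=
  ∃ (M : Type) (_ : TopologicalSpace M), T2Space M ∧ CompactSpace M ∧ PathConnectedSpace M ∧
    LocE M ∧ ∃ W : PF M A, W.IsH1

theorem Real3.congr {A B : Type} [CommGroup A] [CommGroup B] (φ : A ≃* B) (h : Real3 A) :
    Real3 B := by
  obtain ⟨M, _, h1, h2, h3, h4, W, hW⟩ := h
  refine ⟨M, _, h1, h2, h3, h4, W.push φ.toMonoidHom, ?_, ?_⟩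
  · intro b
    obtain ⟨x, γ, h⟩ := hW.1 (φ.symm b)
    refine ⟨x, γ, ?_⟩
    change φ (W.w γ) = b
    rw [h]; simp
  · intro C _ W'
    obtain ⟨k, hk⟩ := hW.2 C _ W'
    refine ⟨k.comp φ.symm.toMonoidHom, fun x γ => ?_⟩
    rw [hk]
    change k (W.w γ) = k (φ.symm (φ (W.w γ)))
    rw [φ.symm_apply_apply]

theorem Real3.prod {A B : Type} [CommGroup A] [CommGroup B] (hA : Real3 A) (hB : Real3 B) :
    Real3 (A × B) := by
  obtain ⟨M, _, h1, h2, h3, h4, W, hW⟩ := hA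
  obtain ⟨N, _, k1, k2, k3, k4, V, hV⟩ := hB
  obtain ⟨m⟩ : Nonempty M := inferInstance
  obtain ⟨n⟩ : Nonempty N := inferInstance
  obtain ⟨e, he, -⟩ := h4 m
  obtain ⟨f, hf, -⟩ := k4 n
  exact ⟨CS e f, inferInstance, inferInstance, cs_compact he hf, cs_pathConnected he hf h4 k4,
    cs_locE he hf h4 k4, csW e f W V, csW_isH1 he hf h4 k4 hW hV⟩

theorem real3_of_quotient (Γ Y : Type) [CommGroup Γ] [MulAction Γ Y] [TopologicalSpace Y]
    [ContinuousConstSMul Γ Y] [ProperlyDiscontinuousSMul Γ Y] [IsCancelSMul Γ Y] [T2Space Y]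
    [SimplyConnectedSpace Y] (hY : LocE Y)
    (hc : CompactSpace (Quotient (MulAction.orbitRel Γ Y))) : Real3 Γ := by
  have := hY.charted
  have : LocallyCompactSpace Y := ChartedSpace.locallyCompactSpace E3 Y
  have hq : IsQuotientCoveringMap (Quotient.mk (MulAction.orbitRel Γ Y)) Γ :=
    isQuotientCoveringMap_quotientMk_of_properlyDiscontinuousSMul
  have hp : PathConnectedSpace (Quotient (MulAction.orbitRel Γ Y)) := inferInstance
  obtain ⟨y⟩ : Nonempty Y := inferInstance
  let φ := (hq.fundamentalGroupEquiv (x := Quotient.mk _ y) ⟨y, rfl⟩)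
  let ψ : Γᵐᵒᵖ ≃* Γ := MulOpposite.opMulEquiv.symm
  obtain ⟨W, hW⟩ := exists_isH1_of_equiv _ (φ.trans ψ)
  exact ⟨Quotient (MulAction.orbitRel Γ Y), inferInstance, inferInstance, hc, hp,
    hY.of_isLocalHomeomorph hq.isCoveringMap.isLocalHomeomorph Quotient.mk_surjective, W, hW⟩

end M3

namespace M3

section S1S2

/-- punctured Euclidean space -/
abbrev PE : Type := {x : E3 // x ≠ 0}

/-- scaling action -/
instance actPE : MulAction (Multiplicative ℤ) PE where
  smul n x := ⟨(2 : ℝ) ^ n.toAdd • x.1, smul_ne_zero (zpow_ne_zero _ two_ne_zero) x.2⟩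
  one_smul x := Subtype.ext (by
    change (2 : ℝ) ^ (0 : ℤ) • x.1 = x.1
    simp)
  mul_smul a b x := Subtype.ext (by
    change (2 : ℝ) ^ (a.toAdd + b.toAdd) • x.1 = (2 : ℝ) ^ a.toAdd • (2 : ℝ) ^ b.toAdd • x.1
    rw [zpow_add₀ two_ne_zero, mul_smul])

theorem PE_smul (n : Multiplicative ℤ) (x : PE) :
    ((n • x : PE) : E3) = (2 : ℝ) ^ n.toAdd • x.1 := rfl

/-- logarithm of the norm -/
def lg (x : PE) : ℝ := Real.logb 2 ‖x.1‖

theorem lg_smul (n : Multiplicative ℤ) (x : PE) : lg (n • x) = (n.toAdd : ℝ) + lg x := by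
  have := norm_pos_iff.2 x.2
  have h2 : ‖(2 : ℝ) ^ n.toAdd‖ = (2 : ℝ) ^ (n.toAdd : ℝ) := by
    rw [Real.rpow_intCast, norm_zpow, Real.norm_ofNat]
  rw [lg, PE_smul, norm_smul, h2, Real.logb_mul (by positivity) this.ne', lg,
    Real.logb_rpow two_pos (by norm_num)]

theorem continuous_lg : Continuous lg := by
  unfold lg Real.logb
  refine Continuous.div_const (Continuous.log (by fun_prop) ?_) _
  intro x
  simpa using x.2

instance : ContinuousConstSMul (Multiplicative ℤ) PE :=
  ⟨fun n => Continuous.subtype_mk (by fun_prop) _⟩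

instance : IsCancelSMul (Multiplicative ℤ) PE where
  left_cancel' a b c h := by
    have := congrArg (fun x => a⁻¹ • x) h
    simpa using this
  right_cancel' a b c h := by
    have := congrArg lg h
    rw [lg_smul, lg_smul] at this
    have h2 : (a.toAdd : ℝ) = b.toAdd := by linarith
    exact Multiplicative.toAdd.injective (by exact_mod_cast h2)

instance : ProperlyDiscontinuousSMul (Multiplicative ℤ) PE where
  finite_disjoint_inter_image {K L} hK hL := by
    obtain ⟨R, hR⟩ := ((hK.union hL).image continuous_lg).isBounded.exists_norm_le
    have hfin : (Multiplicative.toAdd ⁻¹' (Icc (⌊-(2 * R)⌋) ⌈2 * R⌉) :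
        Set (Multiplicative ℤ)).Finite :=
      (finite_Icc _ _).preimage Multiplicative.toAdd.injective.injOn
    refine hfin.subset ?_
    rintro n ⟨y, ⟨x, hx, rfl⟩, hy⟩
    have h1 := hR _ (mem_image_of_mem lg (Or.inl hx))
    have h2 := hR _ (mem_image_of_mem lg (Or.inr hy))
    simp only [lg_smul] at h2
    rw [Real.norm_eq_abs, abs_le] at h1 h2
    constructor
    · have : ((⌊-(2 * R)⌋ : ℤ) : ℝ) ≤ n.toAdd := (Int.floor_le _).trans (by linarith)
      exact_mod_cast this
    · have : (n.toAdd : ℝ) ≤ (⌈2 * R⌉ : ℤ) := le_trans (by linarith) (Int.le_ceil _)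
      exact_mod_cast this

theorem isCompact_lg : IsCompact (lg ⁻¹' Icc 0 1) := by
  rw [IsEmbedding.subtypeVal.isCompact_iff]
  have : Subtype.val '' (lg ⁻¹' Icc 0 1) =
      Metric.closedBall (0 : E3) 2 ∩ {x | 1 ≤ ‖x‖} := by
    ext x
    constructor
    · rintro ⟨y, ⟨h1, h2⟩, rfl⟩
      have := norm_pos_iff.2 y.2
      rw [lg, Real.le_logb_iff_rpow_le one_lt_two this] at h1
      rw [lg, Real.logb_le_iff_le_rpow one_lt_two this] at h2
      simp at h1 h2
      exact ⟨by simpa using h2, h1⟩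
    · rintro ⟨h1, h2⟩
      have h1' := mem_closedBall_zero_iff.1 h1
      have h2' : 1 ≤ ‖x‖ := h2
      have hx : x ≠ 0 := by
        rintro rfl
        simp at h2'
        linarith
      have := norm_pos_iff.2 hx
      refine ⟨⟨x, hx⟩, ⟨?_, ?_⟩, rfl⟩
      · rw [lg, Real.le_logb_iff_rpow_le one_lt_two this]; simpa using h2'
      · rw [lg, Real.logb_le_iff_le_rpow one_lt_two this]; simpa using h1'
  rw [this]
  exact (isCompact_closedBall _ _).inter_right (isClosed_le continuous_const continuous_norm)

theorem real3_int : Real3 (Multiplicative ℤ) := by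
  have := simplyConnected_E3_punct
  have hE : LocE E3 := locE_of_charted
  have hY : LocE PE := hE.isOpen_subtype (U := {x | x ≠ 0}) isOpen_ne
  refine real3_of_quotient (Multiplicative ℤ) PE hY ?_
  have hc := isCompact_lg.image
    (continuous_quotient_mk' (s := MulAction.orbitRel (Multiplicative ℤ) PE))
  rw [← isCompact_univ_iff]
  convert hc
  symm
  apply eq_univ_of_forall
  intro q
  induction q using Quotient.inductionOn with
  | _ x =>
    let n : Multiplicative ℤ := Multiplicative.ofAdd (-⌊lg x⌋)
    refine ⟨n • x, ?_, ?_⟩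
    · rw [mem_preimage, lg_smul]
      have h1 := Int.floor_le (lg x)
      have h2 := Int.lt_floor_add_one (lg x)
      simp only [n, toAdd_ofAdd, Int.cast_neg]
      constructor <;> linarith
    · exact Quotient.sound ⟨n, rfl⟩

end S1S2

section lens

/-- complex 2-space as a real inner product space -/
abbrev F4 : Type := PiLp 2 (fun _ : Fin 2 => ℂ)

theorem finrank_F4 : Module.finrank ℝ F4 = 3 + 1 := by
  rw [(WithLp.linearEquiv 2 ℝ (Fin 2 → ℂ)).finrank_eq, Module.finrank_pi_fintype]
  simp

instance factF4 : Fact (Module.finrank ℝ F4 = 3 + 1) := ⟨finrank_F4⟩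

/-- the 3-sphere -/
abbrev S3 : Type := Metric.sphere (0 : F4) 1

/-- the rotation action -/
@[reducible] def actS3 (n : ℕ) [NeZero n] : MulAction (Multiplicative (ZMod n)) S3 where
  smul a x := ⟨(ZMod.toCircle a.toAdd : ℂ) • x.1, by
    have := x.2
    rw [mem_sphere_zero_iff_norm] at this ⊢
    rw [norm_smul, this, Circle.norm_coe, mul_one]⟩
  one_smul x := Subtype.ext (by
    change (ZMod.toCircle (0 : ZMod n) : ℂ) • x.1 = x.1
    simp)
  mul_smul a b x := Subtype.ext (by
    change (ZMod.toCircle (a.toAdd + b.toAdd) : ℂ) • x.1 =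
      (ZMod.toCircle a.toAdd : ℂ) • (ZMod.toCircle b.toAdd : ℂ) • x.1
    rw [AddChar.map_add_eq_mul, smul_smul]; simp)

theorem real3_zmod (n : ℕ) [NeZero n] : Real3 (Multiplicative (ZMod n)) := by
  let _ := actS3 n
  have : SimplyConnectedSpace S3 := simplyConnected_sphere (by rw [finrank_F4]; norm_num)
  have : ContinuousConstSMul (Multiplicative (ZMod n)) S3 :=
    ⟨fun a => Continuous.subtype_mk (continuous_subtype_val.const_smul (ZMod.toCircle a.toAdd : ℂ)) _⟩
  have : IsCancelSMul (Multiplicative (ZMod n)) S3 :=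
    { left_cancel' := fun a b c h => by
        have := congrArg (fun x => a⁻¹ • x) h
        simpa using this
      right_cancel' := fun a b c h => by
        have h1 : (ZMod.toCircle a.toAdd : ℂ) • c.1 = (ZMod.toCircle b.toAdd : ℂ) • c.1 :=
          congrArg Subtype.val h
        have hc : c.1 ≠ 0 := by
          intro h
          have := c.2
          simp [h] at this
        have h2 := smul_left_injective ℂ hc h1
        exact Multiplicative.toAdd.injective (ZMod.injective_toCircle (Subtype.ext h2)) }
  have : Finite (Multiplicative (ZMod n)) := inferInstance
  have : CompactSpace S3 := isCompact_iff_compactSpace.1 (isCompact_sphere _ _)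
  exact real3_of_quotient (Multiplicative (ZMod n)) S3 locE_of_charted inferInstance

end lens

section final

theorem real3_pi_fin : ∀ (n : ℕ) (A : Fin n → Type) [∀ i, CommGroup (A i)],
    (∀ i, Real3 (A i)) → Real3 (∀ i, A i)
  | 0, A, _, _ => by
    have h := real3_zmod 1
    have : Unique (Multiplicative (ZMod 1)) := inferInstanceAs (Unique (ZMod 1))
    exact h.congr (MulEquiv.ofUnique)
  | n + 1, A, _, hA => by
    have h := (hA 0).prod (real3_pi_fin n (fun i => A i.succ) (fun i => hA i.succ))
    let φ : (∀ i, A i) ≃* A 0 × (∀ i : Fin n, A i.succ) :=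
      { toFun := fun a => (a 0, fun i => a i.succ)
        invFun := fun p => Fin.cons p.1 p.2
        left_inv := fun a => by
          funext i
          refine Fin.cases ?_ (fun i => ?_) i <;> simp
        right_inv := fun p => by simp
        map_mul' := fun a b => rfl }
    exact h.congr φ.symm

theorem real3_pi (ι : Type) [Fintype ι] (A : ι → Type) [∀ i, CommGroup (A i)]
    (h : ∀ i, Real3 (A i)) : Real3 (∀ i, A i) := by
  let eqv := (Fintype.equivFin ι).symm
  have h1 := real3_pi_fin _ (fun k => A (eqv k)) (fun k => h (eqv k))
  let φ : (∀ i, A i) ≃* (∀ k, A (eqv k)) :=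
    { Equiv.piCongrLeft' A eqv.symm with map_mul' := fun a b => rfl }
  exact h1.congr φ.symm

theorem main {G : Type*} [CommGroup G] (hG : Group.FG G) :
    ∃ (N : Type) (_ : TopologicalSpace N) (_ : ChartedSpace (EuclideanSpace ℝ (Fin 3)) N),
      T2Space N ∧ CompactSpace N ∧ ConnectedSpace N ∧ Nonempty N ∧
        ∀ x : N, Nonempty (Abelianization (FundamentalGroup N x) ≃* G) := by
  obtain ⟨ι, j, _, _, p, hp, e, ⟨φ⟩⟩ := CommGroup.equiv_free_prod_prod_multiplicative_zmod G
  have h1 : Real3 (j → Multiplicative ℤ) := real3_pi j _ (fun _ => real3_int)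
  have h2 : Real3 (∀ i : ι, Multiplicative (ZMod (p i ^ e i))) := real3_pi ι _ (fun i =>
    haveI : NeZero (p i ^ e i) := ⟨pow_ne_zero _ (hp i).ne_zero⟩
    real3_zmod _)
  obtain ⟨M, _, k1, k2, k3, k4, W, hW⟩ := h1.prod h2
  refine ⟨M, _, k4.charted, k1, k2, inferInstance, inferInstance, fun x => ?_⟩
  obtain ⟨ψ⟩ := hW.equiv x
  exact ⟨ψ.trans φ.symm⟩

end final

end M3

end

/-- For every finitely generated abelian group `G`, there exists a nonempty
compact connected Hausdorff topological space `N` which is a topological 3-manifold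
(it admits a charted space structure modelled on Euclidean 3-space) such that the
abelianization of the fundamental group of `N` is isomorphic to `G`. -/
theorem exists_closed_three_manifold_with_abelianized_pi1 (G : Type*) [CommGroup G]
    (hG : Group.FG G) :
    ∃ (N : Type) (_ : TopologicalSpace N)
      (_ : ChartedSpace (EuclideanSpace ℝ (Fin 3)) N),
      T2Space N ∧ CompactSpace N ∧ ConnectedSpace N ∧ Nonempty N ∧
        ∀ x : N, Nonempty (Abelianization (FundamentalGroup N x) ≃* G) := by
  exact M3.main hG
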